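/- arXiv:1404.4123 — 10 statements merged into one kernel-verified Lean document; each statement's English description precedes it below -/
import Mathlib

section
/- Let I = (G, w, π) be an instance of the prize-collecting EDS problem. If (ξ, ν, μ) is a feasible solution to the dual LP D(I), then for every edge set F ⊆ E, Σ_{e∈E} ξ(e) ≤ w(F) + w(V(F)) + π(F̃). In particular, if F ⊆ E and a feasible (ξ, ν, μ) satisfy w(F) + w(V(F)) + π(F̃) ≤ Σ_{e∈E} ξ(e), then F is an optimal solution of I. -/
open scoped Classical

namespace EDSDual

variable {V : Type*} [Fintype V] [DecidableEq V]

/-- `f` shares an end node with `e` (in particular every edge shares with itself). -/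
def Shares (e f : Sym2 V) : Prop := ∃ x : V, x ∈ e ∧ x ∈ f

/-- `V(F)`: the set of end nodes of edges in `F`. -/
noncomputable def nodesOf (F : Finset (Sym2 V)) : Finset V :=
  Finset.univ.filter fun v => ∃ e ∈ F, v ∈ e

/-- Feasibility for the dual LP `D(I)` of the prize-collecting EDS problem on
edge set `E`:  `ξ, ν, μ ≥ 0` on the relevant indices,
`Σ_{e ∈ δ(e')} ν(e',e) ≤ w(e')`, `Σ_{e ∈ δ'(v)} μ(v,e) ≤ w(v)`,
`ξ(e) ≤ μ(u,e) + μ(v,e) + ν(e',e)` for `e' = uv ∈ δ(e)`, and `ξ(e) ≤ π(e)`. -/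
def DualFeasible (E : Finset (Sym2 V)) (wE : Sym2 V → ℝ) (wV : V → ℝ)
    (π : Sym2 V → ℝ) (ξ : Sym2 V → ℝ) (ν : Sym2 V → Sym2 V → ℝ)
    (μ : V → Sym2 V → ℝ) : Prop :=
  (∀ e ∈ E, 0 ≤ ξ e) ∧
    (∀ e' ∈ E, ∀ e ∈ E, Shares e' e → 0 ≤ ν e' e) ∧
    (∀ v : V, ∀ e ∈ E, (∃ g ∈ E, v ∈ g ∧ Shares g e) → 0 ≤ μ v e) ∧
    (∀ e' ∈ E, ∑ e ∈ E.filter (fun e => Shares e' e), ν e' e ≤ wE e') ∧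
    (∀ v : V, ∑ e ∈ E.filter (fun e => ∃ g ∈ E, v ∈ g ∧ Shares g e), μ v e ≤ wV v) ∧
    (∀ e ∈ E, ∀ u x : V, s(u, x) ∈ E → Shares s(u, x) e →
      ξ e ≤ μ u e + μ x e + ν s(u, x) e) ∧
    (∀ e ∈ E, ξ e ≤ π e)

/-- The objective value `w(F) + w(V(F)) + π(F̃)` of an edge set `F`, where
`F̃ = {e ∈ E : δ_F(e) = ∅}` is the set of edges not dominated by `F`. -/
noncomputable def edsObj (E F : Finset (Sym2 V)) (wE : Sym2 V → ℝ)
    (wV : V → ℝ) (π : Sym2 V → ℝ) : ℝ :=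
  ∑ e ∈ F, wE e + ∑ v ∈ nodesOf F, wV v +
    ∑ e ∈ E.filter (fun f => ∀ e' ∈ F, ¬ Shares f e'), π e

theorem weak_duality_aux (E : Finset (Sym2 V)) (hE : ∀ e ∈ E, ¬ e.IsDiag)
    (wE : Sym2 V → ℝ) (wV : V → ℝ) (π : Sym2 V → ℝ)
    (ξ : Sym2 V → ℝ) (ν : Sym2 V → Sym2 V → ℝ) (μ : V → Sym2 V → ℝ)
    (hfeas : DualFeasible E wE wV π ξ ν μ) (F : Finset (Sym2 V)) (hF : F ⊆ E) :
    ∑ e ∈ E, ξ e ≤ edsObj E F wE wV π := by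
  obtain ⟨-, h2, h3, h4, h5, h6, h7⟩ := hfeas
  let a : V → Sym2 V → ℝ := fun v e => if ∃ g ∈ E, v ∈ g ∧ Shares g e then μ v e else 0
  let b : Sym2 V → Sym2 V → ℝ := fun f e => if Shares f e then ν f e else 0
  let c : Sym2 V → ℝ := fun e => if ∀ e' ∈ F, ¬ Shares e e' then π e else 0
  have ha : ∀ v, ∀ e ∈ E, 0 ≤ a v e := by
    intro v e he
    simp only [a]
    split_ifs with h
    · exact h3 v e he h
    · exact le_rfl
  have hb : ∀ f ∈ F, ∀ e ∈ E, 0 ≤ b f e := by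
    intro f hf e he
    simp only [b]
    split_ifs with h
    · exact h2 f (hF hf) e he h
    · exact le_rfl
  have key : ∀ e ∈ E, ξ e ≤ ∑ f ∈ F, b f e + ∑ v ∈ nodesOf F, a v e + c e := by
    intro e he
    have hA : 0 ≤ ∑ v ∈ nodesOf F, a v e := Finset.sum_nonneg fun v _ => ha v e he
    have hB : 0 ≤ ∑ f ∈ F, b f e := Finset.sum_nonneg fun f hf => hb f hf e he
    by_cases h : ∀ e' ∈ F, ¬ Shares e e'
    · have : c e = π e := if_pos h
      linarith [h7 e he]
    · have hc : c e = 0 := if_neg h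
      push Not at h
      obtain ⟨f, hf, y, hye, hyf⟩ := h
      have hs : Shares f e := ⟨y, hyf, hye⟩
      have hb1 : b f e ≤ ∑ f ∈ F, b f e :=
        Finset.single_le_sum (f := fun f => b f e) (fun f hf => hb f hf e he) hf
      have hb2 : b f e = ν f e := if_pos hs
      induction f using Sym2.ind with
      | _ u x =>
        have hux : u ≠ x := fun h => hE _ (hF hf) (Sym2.mk_isDiag_iff.2 h)
        have hsub : ({u, x} : Finset V) ⊆ nodesOf F := by
          intro v hv
          simp only [nodesOf, Finset.mem_filter, Finset.mem_univ, true_and]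
          refine ⟨_, hf, ?_⟩
          simpa using hv
        have h8 : ∑ v ∈ ({u, x} : Finset V), a v e ≤ ∑ v ∈ nodesOf F, a v e :=
          Finset.sum_le_sum_of_subset_of_nonneg hsub fun v _ _ => ha v e he
        rw [Finset.sum_pair hux] at h8
        have hau : a u e = μ u e := if_pos ⟨_, hF hf, Sym2.mem_mk_left u x, hs⟩
        have hax : a x e = μ x e := if_pos ⟨_, hF hf, Sym2.mem_mk_right u x, hs⟩
        linarith [h6 e he u x (hF hf) hs]
  calc ∑ e ∈ E, ξ e ≤ ∑ e ∈ E, (∑ f ∈ F, b f e + ∑ v ∈ nodesOf F, a v e + c e) :=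
        Finset.sum_le_sum key
    _ = ∑ f ∈ F, ∑ e ∈ E, b f e + ∑ v ∈ nodesOf F, ∑ e ∈ E, a v e + ∑ e ∈ E, c e := by
        rw [Finset.sum_add_distrib, Finset.sum_add_distrib, Finset.sum_comm,
          Finset.sum_comm (s := E) (t := nodesOf F)]
    _ ≤ edsObj E F wE wV π := by
        unfold edsObj
        refine add_le_add (add_le_add (Finset.sum_le_sum fun f hf => ?_)
          (Finset.sum_le_sum fun v _ => ?_)) ?_
        · simp only [b]
          rw [← Finset.sum_filter]
          exact h4 f (hF hf)
        · simp only [a]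
          rw [← Finset.sum_filter]
          exact h5 v
        · simp only [c]
          rw [← Finset.sum_filter]

/-- Weak duality for the prize-collecting EDS problem: the dual objective of
any feasible dual solution lower-bounds the objective value of every edge set
`F ⊆ E`; in particular, an `F` whose objective value is at most the dual
objective is optimal. -/
theorem dual_weak_duality (G : SimpleGraph V)
    (wE : Sym2 V → ℝ) (wV : V → ℝ) (π : Sym2 V → ℝ)
    (hwE : ∀ e, 0 ≤ wE e) (hwV : ∀ v, 0 ≤ wV v) (hπ : ∀ e, 0 ≤ π e)
    (ξ : Sym2 V → ℝ) (ν : Sym2 V → Sym2 V → ℝ) (μ : V → Sym2 V → ℝ)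
    (hfeas : DualFeasible G.edgeFinset wE wV π ξ ν μ) :
    (∀ F ⊆ G.edgeFinset,
        ∑ e ∈ G.edgeFinset, ξ e ≤ edsObj G.edgeFinset F wE wV π) ∧
      (∀ F ⊆ G.edgeFinset,
        edsObj G.edgeFinset F wE wV π ≤ ∑ e ∈ G.edgeFinset, ξ e →
        ∀ F' ⊆ G.edgeFinset,
          edsObj G.edgeFinset F wE wV π ≤ edsObj G.edgeFinset F' wE wV π) := by
  have hE : ∀ e ∈ G.edgeFinset, ¬ e.IsDiag := fun e he =>
    G.not_isDiag_of_mem_edgeSet (SimpleGraph.mem_edgeFinset.1 he)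
  have main := weak_duality_aux G.edgeFinset hE wE wV π ξ ν μ hfeas
  exact ⟨main, fun F _ h F' hF' => h.trans (main F' hF')⟩

end EDSDual
end

section
/- Let I = (G, w, π) be an instance of the prize-collecting EDS problem in which G is a star with center r and at least one edge. Let α₁ = min_{rv∈E} (w(rv) + w(r) + w(v)) and α₂ = Σ_{e∈E} π(e). Suppose ξ : E → ℝ≥0 satisfies ξ(e) ≤ π(e) for each e ∈ E and Σ_{e∈E} ξ(e) ≤ min{α₁, α₂} (in particular this holds when ξ(e) = π(e) for all e in the case α₁ ≥ α₂, and when Σ_{e∈E} ξ(e) = α₁ with ξ ≤ π in the case α₁ < α₂). Then there exist ν and μ such that (ξ, ν, μ) is a feasible solution to the dual LP D(I). -/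
open scoped Classical

namespace EDSStarDual

variable {V : Type*} [Fintype V] [DecidableEq V]

/-- `f` shares an end node with `e` (in particular every edge shares with itself). -/
def Shares (e f : Sym2 V) : Prop := ∃ x : V, x ∈ e ∧ x ∈ f

/-- Feasibility for the dual LP `D(I)` of the prize-collecting EDS problem on
edge set `E`. -/
def DualFeasible (E : Finset (Sym2 V)) (wE : Sym2 V → ℝ) (wV : V → ℝ)
    (π : Sym2 V → ℝ) (ξ : Sym2 V → ℝ) (ν : Sym2 V → Sym2 V → ℝ)
    (μ : V → Sym2 V → ℝ) : Prop :=
  (∀ e ∈ E, 0 ≤ ξ e) ∧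
    (∀ e' ∈ E, ∀ e ∈ E, Shares e' e → 0 ≤ ν e' e) ∧
    (∀ v : V, ∀ e ∈ E, (∃ g ∈ E, v ∈ g ∧ Shares g e) → 0 ≤ μ v e) ∧
    (∀ e' ∈ E, ∑ e ∈ E.filter (fun e => Shares e' e), ν e' e ≤ wE e') ∧
    (∀ v : V, ∑ e ∈ E.filter (fun e => ∃ g ∈ E, v ∈ g ∧ Shares g e), μ v e ≤ wV v) ∧
    (∀ e ∈ E, ∀ u x : V, s(u, x) ∈ E → Shares s(u, x) e →
      ξ e ≤ μ u e + μ x e + ν s(u, x) e) ∧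
    (∀ e ∈ E, ξ e ≤ π e)

/-- If `G` is a star with center `r` and `ξ : E → ℝ≥0` satisfies `ξ ≤ π` and
`Σ_{e ∈ E} ξ(e) ≤ min{α₁, α₂}`, then `ξ` extends to a feasible solution
`(ξ, ν, μ)` of the dual LP `D(I)`. -/
theorem star_dual_feasible (G : SimpleGraph V) (r : V)
    (hstar : ∀ e ∈ G.edgeFinset, r ∈ e)
    (hne : (G.neighborFinset r).Nonempty)
    (wE : Sym2 V → ℝ) (wV : V → ℝ) (π : Sym2 V → ℝ)
    (hwE : ∀ e, 0 ≤ wE e) (hwV : ∀ v, 0 ≤ wV v) (hπ : ∀ e, 0 ≤ π e)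
    (ξ : Sym2 V → ℝ)
    (hξ0 : ∀ e ∈ G.edgeFinset, 0 ≤ ξ e)
    (hξπ : ∀ e ∈ G.edgeFinset, ξ e ≤ π e)
    (hξsum : ∑ e ∈ G.edgeFinset, ξ e ≤
      min ((G.neighborFinset r).inf' hne fun v => wE s(r, v) + wV r + wV v)
          (∑ e ∈ G.edgeFinset, π e)) :
    ∃ (ν : Sym2 V → Sym2 V → ℝ) (μ : V → Sym2 V → ℝ),
      DualFeasible G.edgeFinset wE wV π ξ ν μ := by
  set S := ∑ e ∈ G.edgeFinset, ξ e with hS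
  have hS0 : 0 ≤ S := Finset.sum_nonneg hξ0
  have hk0 : ∀ e ∈ G.edgeFinset, 0 ≤ ξ e / S := fun e he => div_nonneg (hξ0 e he) hS0
  have key : ∀ (p : Sym2 V → Prop) [DecidablePred p] (c : ℝ), 0 ≤ c →
      ∑ e ∈ G.edgeFinset.filter p, ξ e / S * c ≤ c := by
    intro p _ c hc
    have h1 : ∑ e ∈ G.edgeFinset.filter p, ξ e / S * c
        ≤ ∑ e ∈ G.edgeFinset, ξ e / S * c :=
      Finset.sum_le_sum_of_subset_of_nonneg (Finset.filter_subset _ _)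
        (fun e he _ => mul_nonneg (hk0 e he) hc)
    have h2 : ∑ e ∈ G.edgeFinset, ξ e / S * c = S / S * c := by
      rw [← Finset.sum_mul, ← Finset.sum_div]
    exact (h1.trans h2.le).trans (mul_le_of_le_one_left hc (div_self_le_one S))
  have hα : ∀ v, G.Adj r v → S ≤ wE s(r, v) + wV r + wV v := by
    intro v hv
    exact (hξsum.trans (min_le_left _ _)).trans
      (Finset.inf'_le (fun v => wE s(r, v) + wV r + wV v) (by simpa using hv))
  refine ⟨fun e' e => ξ e / S * wE e', fun v e => ξ e / S * wV v, hξ0, ?_, ?_, ?_, ?_, ?_, hξπ⟩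
  · exact fun e' _ e he _ => mul_nonneg (hk0 e he) (hwE e')
  · exact fun v e he _ => mul_nonneg (hk0 e he) (hwV v)
  · intro e' _
    exact key (fun e => Shares e' e) (wE e') (hwE e')
  · intro v
    exact key (fun e => ∃ g ∈ G.edgeFinset, v ∈ g ∧ Shares g e) (wV v) (hwV v)
  · intro e he u x hux _
    have hb : S ≤ wV u + wV x + wE s(u, x) := by
      have hr := hstar _ hux
      have hadj : G.Adj u x := by simpa using hux
      rcases Sym2.mem_iff.1 hr with h | h
      · subst h
        linarith [hα x hadj]
      · subst h
        have := hα u hadj.symm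
        rw [Sym2.eq_swap] at this
        linarith
    have hle : ξ e ≤ S := Finset.single_le_sum hξ0 he
    have hx : ξ e = ξ e / S * S := by
      rcases hS0.eq_or_lt with h | h
      · have := hξ0 e he
        rw [← h]
        linarith
      · field_simp
    calc ξ e = ξ e / S * S := hx
      _ ≤ ξ e / S * (wV u + wV x + wE s(u, x)) := mul_le_mul_of_nonneg_left hb (hk0 e he)
      _ = _ := by ring

end EDSStarDual
end

section
/- (Case B optimality lemma.) In the Case B setting, additionally let K = {i ∈ [k] : w(u_i) + w(v_i) + w(h_i) ≤ π(e_i)} and let i* ∈ [k]* attain θ₁ = w(e_{i*}) + w(u_{i*}) + w(s). Suppose F' ⊆ E' and a feasible solution (ξ', ν', μ') of D(I') satisfy w'(F') + w'(V(F')) + π'(F̃') ≤ Σ_{f∈E'} ξ'(f), and that |δ_{F'}(e₀)| ≤ 1. Let ξ : E → ℝ≥0 be as in the Case B dual feasibility lemma: ξ(e_i) ≤ min{w(u_i) + w(v_i) + w(h_i), π(e_i)} for i ∈ [k], Σ_{i=1}^k ξ(e_i) = θ, ξ(f) = 0 for f ∈ ∪_{i=1}^k H_i, and ξ(f) = ξ'(f)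 for every other edge. Define F ⊆ E by: F = F' ∪ {e₀} if δ_{F'}(u₀) ≠ ∅ and θ > w(s) + w(e₀); F = F' if (δ_{F'}(u₀) = ∅ or θ ≤ w(s) + w(e₀)) and δ_{F'}(s) ≠ ∅; F = F' ∪ {h_i : i ∈ K} if (δ_{F'}(u₀) = ∅ or θ ≤ w(s) + w(e₀)), δ_{F'}(s) = ∅, and θ₁ ≥ θ₂; F = F' ∪ {e_{i*}} if (δ_{F'}(u₀) = ∅ or θ ≤ w(s) + w(e₀)), δ_{F'}(s) = ∅, and θ₁ < θ₂. Then w(F) + w(V(F)) + π(F̃) ≤ Σ_{f∈E} ξ(f). -/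
open scoped Classical

namespace EDSCaseBOpt

variable {V : Type*} [Fintype V] [DecidableEq V]

/-- `f` shares an end node with `e` (in particular every edge shares with itself). -/
def Shares (e f : Sym2 V) : Prop := ∃ x : V, x ∈ e ∧ x ∈ f

/-- `V(F)`: the set of end nodes of edges in `F`. -/
noncomputable def nodesOf (F : Finset (Sym2 V)) : Finset V :=
  Finset.univ.filter fun v => ∃ e ∈ F, v ∈ e

/-- Feasibility for the dual LP `D(I)` of the prize-collecting EDS problem on
edge set `E`. -/
def DualFeasible (E : Finset (Sym2 V)) (wE : Sym2 V → ℝ) (wV : V → ℝ)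
    (π : Sym2 V → ℝ) (ξ : Sym2 V → ℝ) (ν : Sym2 V → Sym2 V → ℝ)
    (μ : V → Sym2 V → ℝ) : Prop :=
  (∀ e ∈ E, 0 ≤ ξ e) ∧
    (∀ e' ∈ E, ∀ e ∈ E, Shares e' e → 0 ≤ ν e' e) ∧
    (∀ v : V, ∀ e ∈ E, (∃ g ∈ E, v ∈ g ∧ Shares g e) → 0 ≤ μ v e) ∧
    (∀ e' ∈ E, ∑ e ∈ E.filter (fun e => Shares e' e), ν e' e ≤ wE e') ∧
    (∀ v : V, ∑ e ∈ E.filter (fun e => ∃ g ∈ E, v ∈ g ∧ Shares g e), μ v e ≤ wV v) ∧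
    (∀ e ∈ E, ∀ u x : V, s(u, x) ∈ E → Shares s(u, x) e →
      ξ e ≤ μ u e + μ x e + ν s(u, x) e) ∧
    (∀ e ∈ E, ξ e ≤ π e)

/-- The objective value `w(F) + w(V(F)) + π(F̃)` of an edge set `F`. -/
noncomputable def edsObj (E F : Finset (Sym2 V)) (wE : Sym2 V → ℝ)
    (wV : V → ℝ) (π : Sym2 V → ℝ) : ℝ :=
  ∑ e ∈ F, wE e + ∑ v ∈ nodesOf F, wV v +
    ∑ e ∈ E.filter (fun f => ∀ e' ∈ F, ¬ Shares f e'), π e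

section Tree

theorem parent_unique {W : Type*} (G : SimpleGraph W) (hG : G.IsTree) (r a x y : W)
    (hx : G.Adj a x) (hy : G.Adj a y) (hdx : G.dist r x + 1 = G.dist r a)
    (hdy : G.dist r y + 1 = G.dist r a) : x = y := by
  obtain ⟨p, hp⟩ := hG.connected.exists_walk_length_eq_dist r x
  obtain ⟨q, hq⟩ := hG.connected.exists_walk_length_eq_dist r y
  have h1 : (p.concat hx.symm).IsPath :=
    SimpleGraph.Walk.isPath_of_length_eq_dist _ (by rw [SimpleGraph.Walk.length_concat]; omega)
  have h2 : (q.concat hy.symm).IsPath :=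
    SimpleGraph.Walk.isPath_of_length_eq_dist _ (by rw [SimpleGraph.Walk.length_concat]; omega)
  have h := (hG.existsUnique_path r a).unique h1 h2
  obtain ⟨h3, -⟩ := SimpleGraph.Walk.concat_inj h
  exact h3

theorem farthest_leaf {W : Type*} [Fintype W] (G : SimpleGraph W) (hG : G.IsTree) (r z : W)
    (hz : ∀ y, G.dist r y ≤ G.dist r z) (y₀ : W) (hy₀ : G.Adj z y₀) :
    G.degree z = 1 := by
  rw [SimpleGraph.degree_eq_one_iff_existsUnique_adj]
  have key : ∀ y, G.Adj z y → G.dist r y + 1 = G.dist r z := by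
    intro y hy
    have := hG.dist_eq_dist_add_one_of_adj r hy
    have := hz y
    omega
  exact ⟨y₀, hy₀, fun y hy => parent_unique G hG r z y y₀ hy hy₀ (key y hy) (key y₀ hy₀)⟩

end Tree

section Sums

theorem sum_le_add_of_pointwise {α : Type*} [Fintype α] (A B T : Finset α) (a b c : α → ℝ)
    (h : ∀ x, (if x ∈ A then a x else 0) ≤
      (if x ∈ B then b x else 0) + (if x ∈ T then c x else 0)) :
    ∑ x ∈ A, a x ≤ ∑ x ∈ B, b x + ∑ x ∈ T, c x := by
  have := Finset.sum_le_sum (s := Finset.univ) (fun x _ => h x)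
  rw [Finset.sum_add_distrib] at this
  simpa using this

theorem add_le_sum_of_pointwise {α : Type*} [Fintype α] (A B T : Finset α) (a b c : α → ℝ)
    (h : ∀ x, (if x ∈ B then b x else 0) + (if x ∈ T then c x else 0) ≤
      (if x ∈ A then a x else 0)) :
    ∑ x ∈ B, b x + ∑ x ∈ T, c x ≤ ∑ x ∈ A, a x := by
  have := Finset.sum_le_sum (s := Finset.univ) (fun x _ => h x)
  rw [Finset.sum_add_distrib] at this
  simpa using this

theorem sum_le_add (α : Type*) [Fintype α] (A B T : Finset α) (a b c : α → ℝ)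
    (hb : ∀ x, 0 ≤ b x) (hc : ∀ x ∈ T, 0 ≤ c x)
    (h : ∀ x ∈ A, (x ∈ B ∧ a x ≤ b x) ∨ (x ∈ T ∧ a x ≤ c x) ∨
      (x ∈ B ∧ x ∈ T ∧ a x ≤ b x + c x) ∨ a x ≤ 0) :
    ∑ x ∈ A, a x ≤ ∑ x ∈ B, b x + ∑ x ∈ T, c x := by
  apply sum_le_add_of_pointwise
  intro x
  have h1 := h x
  have h2 := hb x
  have h3 := hc x
  split_ifs with hA hB hT hT hB hT hT <;> simp_all <;> grind

theorem sum_image_le' {α β : Type*} [DecidableEq β] (K : Finset α) (g : α → β) (c : β → ℝ)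
    (hc : ∀ x, 0 ≤ c x) : ∑ x ∈ K.image g, c x ≤ ∑ i ∈ K, c (g i) := by
  exact Finset.sum_image_le_of_nonneg (fun i _ => hc _)

end Sums

theorem mem_nodesOf (F : Finset (Sym2 V)) (v : V) : v ∈ nodesOf F ↔ ∃ e ∈ F, v ∈ e := by
  simp [nodesOf]

/-- Case B optimality lemma.  In the Case B setting, with
`K = {i ∈ [k] : w(u_i)+w(v_i)+w(h_i) ≤ π(e_i)}` and `i*` attaining `θ₁`, if
`F'` and the feasible dual solution `(ξ', ν', μ')` of the reduced instance
satisfy the induction inequality, `|δ_{F'}(e₀)| ≤ 1`, `ξ` is defined by the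
Case B rule, and `F` is obtained from `F'` by the Case B rule, then
`w(F) + w(V(F)) + π(F̃) ≤ Σ_{f ∈ E} ξ(f)`. -/
theorem caseB_optimality (G : SimpleGraph V) (hG : G.IsTree) (r : V)
    (wE : Sym2 V → ℝ) (wV : V → ℝ) (π : Sym2 V → ℝ)
    (hwE : ∀ e, 0 ≤ wE e) (hwV : ∀ v, 0 ≤ wV v) (hπ : ∀ e, 0 ≤ π e)
    (hπ0 : ∀ a b : V, G.Adj a b → G.degree b = 1 →
      (∀ b' : V, G.degree b' = 1 → G.dist r b' ≤ G.dist r b) → π s(a, b) = 0)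
    (sN u₀ : V) (k : ℕ) (hk : 1 ≤ k) (ut : Fin (k + 1) → V)
    (hinj : Function.Injective ut)
    (hadj : ∀ i, G.Adj sN (ut i))
    (hnbr : ∀ x : V, G.Adj sN x → ∃ i, ut i = x)
    (hu0 : ut 0 = u₀)
    (hparent : G.dist r u₀ + 1 = G.dist r sN)
    (Vch : Fin (k + 1) → Finset V)
    (hVch : ∀ i : Fin (k + 1), i ≠ 0 →
      ∀ x : V, x ∈ Vch i ↔ (G.Adj (ut i) x ∧ x ≠ sN))
    (hVchne : ∀ i : Fin (k + 1), i ≠ 0 → (Vch i).Nonempty)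
    (i₀ : Fin (k + 1)) (hi₀ : i₀ ≠ 0) (ℓ : V) (hℓmem : ℓ ∈ Vch i₀)
    (hℓleaf : G.degree ℓ = 1)
    (hℓmax : ∀ b : V, G.degree b = 1 → G.dist r b ≤ G.dist r ℓ)
    (vsel : Fin (k + 1) → V)
    (hvsel : ∀ i : Fin (k + 1), i ≠ 0 → vsel i ∈ Vch i ∧
      ∀ x ∈ Vch i, wE s(ut i, vsel i) + wV (vsel i) ≤ wE s(ut i, x) + wV x)
    (θ₁ θ₂ θ : ℝ)
    (hθ₁ : θ₁ = (Finset.univ : Finset (Fin (k + 1))).inf' Finset.univ_nonempty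
      (fun i => wE s(sN, ut i) + wV (ut i) + wV sN))
    (hθ₂ : θ₂ = ∑ i ∈ Finset.univ.filter (fun i : Fin (k + 1) => i ≠ 0),
      min (wV (ut i) + wV (vsel i) + wE s(ut i, vsel i)) (π s(sN, ut i)))
    (hθ : θ = min θ₁ θ₂)
    (K : Finset (Fin (k + 1)))
    (hK : K = Finset.univ.filter (fun i : Fin (k + 1) => i ≠ 0 ∧
      wV (ut i) + wV (vsel i) + wE s(ut i, vsel i) ≤ π s(sN, ut i)))
    (istar : Fin (k + 1))
    (histar : wE s(sN, ut istar) + wV (ut istar) + wV sN = θ₁)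
    -- the reduced instance I' = (G', w', π')
    (E' : Finset (Sym2 V))
    (hE' : E' = if θ₂ ≤ θ₁ then
        G.edgeFinset.filter (fun f =>
          ¬ ∃ i : Fin (k + 1), i ≠ 0 ∧ ∃ x ∈ Vch i, f = s(ut i, x))
      else
        G.edgeFinset.filter (fun f =>
          ¬ ∃ i : Fin (k + 1), i ≠ 0 ∧ ∃ a : V, a ∈ f ∧
            G.dist r (ut i) + G.dist (ut i) a = G.dist r a))
    (π' : Sym2 V → ℝ)
    (hπ' : ∀ f, π' f = if θ₂ ≤ θ₁ then
        (if ∃ i : Fin (k + 1), i ≠ 0 ∧ f = s(sN, ut i) then 0 else π f)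
      else (if f = s(sN, ut 0) then 0 else π f))
    (wE' : Sym2 V → ℝ)
    (hwE' : ∀ f, wE' f = if ∃ i : Fin (k + 1), f = s(sN, ut i) then
        max (wE f - max (θ - wV sN) 0) 0 else wE f)
    (wV' : V → ℝ)
    (hwV's : wV' sN = max (wV sN - θ) 0)
    (hwV'u : ∀ i : Fin (k + 1),
      wV' (ut i) = wV (ut i) - max (θ - wV sN - wE s(sN, ut i)) 0)
    (hwV'other : ∀ x : V, x ≠ sN → (∀ i, x ≠ ut i) → wV' x = wV x)
    -- the inductively obtained solutions for I'
    (F' : Finset (Sym2 V)) (hF'E : F' ⊆ E')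
    (ξ' : Sym2 V → ℝ) (ν' : Sym2 V → Sym2 V → ℝ) (μ' : V → Sym2 V → ℝ)
    (hdual' : DualFeasible E' wE' wV' π' ξ' ν' μ')
    (hopt' : edsObj E' F' wE' wV' π' ≤ ∑ f ∈ E', ξ' f)
    (hdeg : (F'.filter (fun f => Shares s(sN, ut 0) f)).card ≤ 1)
    -- the new ξ
    (ξ : Sym2 V → ℝ)
    (hξ0 : ∀ f ∈ G.edgeFinset, 0 ≤ ξ f)
    (hξe : ∀ i : Fin (k + 1), i ≠ 0 → ξ s(sN, ut i) ≤
      min (wV (ut i) + wV (vsel i) + wE s(ut i, vsel i)) (π s(sN, ut i)))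
    (hξsum : ∑ i ∈ Finset.univ.filter (fun i : Fin (k + 1) => i ≠ 0),
      ξ s(sN, ut i) = θ)
    (hξH : ∀ i : Fin (k + 1), i ≠ 0 → ∀ x ∈ Vch i, ξ s(ut i, x) = 0)
    (hξrest : ∀ f ∈ G.edgeFinset,
      (¬ ∃ i : Fin (k + 1), i ≠ 0 ∧ f = s(sN, ut i)) →
      (¬ ∃ i : Fin (k + 1), i ≠ 0 ∧ ∃ x ∈ Vch i, f = s(ut i, x)) →
      ξ f = ξ' f)
    -- the new solution F
    (F : Finset (Sym2 V))
    (hF : F = if (∃ f ∈ F', u₀ ∈ f) ∧ wV sN + wE s(sN, ut 0) < θ then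
        F' ∪ {s(sN, ut 0)}
      else if ∃ f ∈ F', sN ∈ f then F'
      else if θ₂ ≤ θ₁ then F' ∪ K.image (fun i => s(ut i, vsel i))
      else F' ∪ {s(sN, ut istar)}) :
    edsObj G.edgeFinset F wE wV π ≤ ∑ f ∈ G.edgeFinset, ξ f := by
  have hs_ne : ∀ i, sN ≠ ut i := fun i => (hadj i).ne
  have einj : ∀ i j, s(sN, ut i) = s(sN, ut j) → i = j := by
    intro i j h
    rw [Sym2.congr_right] at h
    exact hinj h
  have hdu : ∀ i, i ≠ 0 → G.dist r (ut i) = G.dist r sN + 1 := by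
    intro i hi
    rcases hG.dist_eq_dist_add_one_of_adj r (hadj i) with h | h
    · exfalso
      have := parent_unique G hG r sN (ut i) (ut 0) (hadj i) (hadj 0) h.symm (by rw [hu0]; exact hparent)
      exact hi (hinj this)
    · exact h
  have hdx : ∀ i, i ≠ 0 → ∀ x ∈ Vch i, G.dist r x = G.dist r sN + 2 := by
    intro i hi x hx
    obtain ⟨h1, h2⟩ := (hVch i hi x).1 hx
    have h3 := hdu i hi
    rcases hG.dist_eq_dist_add_one_of_adj r h1 with h | h
    · exfalso
      exact h2 (parent_unique G hG r (ut i) x sN h1 (hadj i).symm h.symm h3.symm)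
    · omega
  have hmax : ∀ y, G.dist r y ≤ G.dist r sN + 2 := by
    obtain ⟨z, -, hz⟩ := Finset.exists_max_image (Finset.univ : Finset V) (fun y => G.dist r y)
      ⟨r, Finset.mem_univ _⟩
    have hz' : ∀ y, G.dist r y ≤ G.dist r z := fun y => hz y (Finset.mem_univ _)
    have : Nontrivial V := ⟨⟨sN, ut 0, hs_ne 0⟩⟩
    obtain ⟨y₀, hy₀⟩ := hG.connected.preconnected.exists_adj_of_nontrivial z
    have h1 := hℓmax z (farthest_leaf G hG r z hz' y₀ hy₀)
    have h2 := hdx i₀ hi₀ ℓ hℓmem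
    intro y
    have := hz' y
    omega
  have hleaf : ∀ i, i ≠ 0 → ∀ x ∈ Vch i, G.degree x = 1 := by
    intro i hi x hx
    obtain ⟨h1, h2⟩ := (hVch i hi x).1 hx
    refine farthest_leaf G hG r x ?_ (ut i) h1.symm
    intro y
    rw [hdx i hi x hx]
    exact hmax y
  have hπH : ∀ i, i ≠ 0 → ∀ x ∈ Vch i, π s(ut i, x) = 0 := by
    intro i hi x hx
    obtain ⟨h1, h2⟩ := (hVch i hi x).1 hx
    refine hπ0 _ _ h1 (hleaf i hi x hx) ?_
    intro b hb
    rw [hdx i hi x hx]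
    exact hmax b
  have hHuniq : ∀ i, i ≠ 0 → ∀ x ∈ Vch i, ∀ f ∈ G.edgeFinset, x ∈ f → f = s(ut i, x) := by
    intro i hi x hx f hf hxf
    obtain ⟨h1, h2⟩ := (hVch i hi x).1 hx
    obtain ⟨y, rfl⟩ := Sym2.mem_iff_exists.1 hxf
    have h3 := hleaf i hi x hx
    rw [SimpleGraph.degree_eq_one_iff_existsUnique_adj] at h3
    rw [SimpleGraph.mem_edgeFinset, SimpleGraph.mem_edgeSet] at hf
    rw [h3.unique hf h1.symm, Sym2.eq_swap]
  have heE : ∀ i, s(sN, ut i) ∈ G.edgeFinset := by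
    intro i
    rw [SimpleGraph.mem_edgeFinset, SimpleGraph.mem_edgeSet]
    exact hadj i
  have heH : ∀ j, ¬ ∃ i : Fin (k + 1), i ≠ 0 ∧ ∃ x ∈ Vch i, s(sN, ut j) = s(ut i, x) := by
    rintro j ⟨i, hi, x, hx, h⟩
    have h2 := ((hVch i hi x).1 hx).2
    rw [Sym2.eq_iff] at h
    rcases h with ⟨h, -⟩ | ⟨h, -⟩
    · exact hs_ne i h
    · exact h2 h.symm
  have hu_edge : ∀ i, i ≠ 0 → ∀ f ∈ G.edgeFinset, ut i ∈ f →
      f = s(sN, ut i) ∨ ∃ x ∈ Vch i, f = s(ut i, x) := by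
    intro i hi f hf hif
    obtain ⟨y, rfl⟩ := Sym2.mem_iff_exists.1 hif
    rw [SimpleGraph.mem_edgeFinset, SimpleGraph.mem_edgeSet] at hf
    by_cases hy : y = sN
    · left; rw [hy, Sym2.eq_swap]
    · right; exact ⟨y, (hVch i hi y).2 ⟨hf, hy⟩, rfl⟩
  have hE'sub : E' ⊆ G.edgeFinset := by
    rw [hE']; split_ifs <;> exact Finset.filter_subset _ _
  have hE'H : ∀ f ∈ E', ¬ ∃ i : Fin (k + 1), i ≠ 0 ∧ ∃ x ∈ Vch i, f = s(ut i, x) := by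
    intro f hf
    rw [hE'] at hf
    split_ifs at hf with h
    · exact (Finset.mem_filter.1 hf).2
    · rintro ⟨i, hi, x, hx, rfl⟩
      exact (Finset.mem_filter.1 hf).2 ⟨i, hi, ut i, by simp, by simp⟩
  have hE'u : ∀ f ∈ E', ∀ i, i ≠ 0 → ut i ∈ f → f = s(sN, ut i) := by
    intro f hf i hi hif
    rcases hu_edge i hi f (hE'sub hf) hif with h | h
    · exact h
    · exact absurd ⟨i, hi, h⟩ (hE'H f hf)
  have hE'B : ¬ θ₂ ≤ θ₁ → ∀ i, i ≠ 0 → s(sN, ut i) ∉ E' := by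
    intro h i hi hf
    rw [hE', if_neg h] at hf
    exact (Finset.mem_filter.1 hf).2 ⟨i, hi, ut i, by simp, by simp⟩
  have hE'cover : ∀ f ∈ G.edgeFinset, f ∉ E' →
      (∃ i : Fin (k + 1), i ≠ 0 ∧ f = s(sN, ut i)) ∨
      (∃ i : Fin (k + 1), i ≠ 0 ∧ ∃ x ∈ Vch i, f = s(ut i, x)) := by
    intro f hf hf'
    rw [hE'] at hf'
    split_ifs at hf' with h
    · right
      by_contra hc
      exact hf' (Finset.mem_filter.2 ⟨hf, hc⟩)
    · have : ∃ i : Fin (k + 1), i ≠ 0 ∧ ∃ a : V, a ∈ f ∧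
            G.dist r (ut i) + G.dist (ut i) a = G.dist r a := by
        by_contra hc
        exact hf' (Finset.mem_filter.2 ⟨hf, hc⟩)
      obtain ⟨i, hi, a, haf, hd⟩ := this
      have h1 := hdu i hi
      have h2 := hmax a
      rcases Nat.lt_or_ge 0 (G.dist (ut i) a) with h3 | h3
      · have h4 : G.dist (ut i) a = 1 := by omega
        have h5 := SimpleGraph.dist_eq_one_iff_adj.1 h4
        have h6 : a ≠ sN := by rintro rfl; omega
        have h7 := (hVch i hi a).2 ⟨h5, h6⟩
        exact Or.inr ⟨i, hi, a, h7, hHuniq i hi a h7 f hf haf⟩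
      · have h4 : ut i = a := hG.connected.dist_eq_zero_iff.1 (by omega)
        rcases hu_edge i hi f hf (by rw [h4]; exact haf) with h5 | h5
        · exact Or.inl ⟨i, hi, h5⟩
        · exact Or.inr ⟨i, hi, h5⟩
  have hθ₁le : ∀ i, θ₁ ≤ wE s(sN, ut i) + wV (ut i) + wV sN := by
    intro i
    rw [hθ₁]
    exact Finset.inf'_le _ (Finset.mem_univ i)
  have hθle : ∀ i, θ ≤ wE s(sN, ut i) + wV (ut i) + wV sN := fun i =>
    le_trans (by rw [hθ]; exact min_le_left _ _) (hθ₁le i)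
  have hθ0 : 0 ≤ θ := by
    rw [← hξsum]
    exact Finset.sum_nonneg fun i _ => hξ0 _ (heE i)
  have hwV'0 : ∀ v, 0 ≤ wV' v := by
    intro v
    by_cases h1 : v = sN
    · rw [h1, hwV's]; exact le_max_right _ _
    by_cases h2 : ∃ i, v = ut i
    · obtain ⟨i, rfl⟩ := h2
      rw [hwV'u i, sub_nonneg]
      refine max_le ?_ (hwV _)
      have := hθle i
      linarith
    · rw [hwV'other v h1 (fun i hi => h2 ⟨i, hi⟩)]; exact hwV v
  have hwE'0 : ∀ e, 0 ≤ wE' e := by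
    intro e
    rw [hwE']
    split_ifs
    · exact le_max_right _ _
    · exact hwE e
  have hwE'e : ∀ i, wE' s(sN, ut i) = max (wE s(sN, ut i) - max (θ - wV sN) 0) 0 := by
    intro i
    rw [hwE', if_pos ⟨i, rfl⟩]
  have hπ'0 : ∀ e, 0 ≤ π' e := by
    intro e
    rw [hπ']
    split_ifs <;> first | exact le_rfl | exact hπ e
  obtain ⟨hξ'0, -, -, -, -, -, hξ'π⟩ := hdual'
  have hS : ∑ f ∈ E', ξ' f + θ ≤ ∑ f ∈ G.edgeFinset, ξ f := by
    have h1 : ∑ f ∈ (Finset.univ.filter (fun i : Fin (k + 1) => i ≠ 0)).image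
        (fun i => s(sN, ut i)), ξ f = θ := by
      rw [Finset.sum_image (fun i _ j _ h => einj i j h)]
      exact hξsum
    rw [← h1]
    apply add_le_sum_of_pointwise
    intro x
    by_cases hxE : x ∈ G.edgeFinset
    · rw [if_pos hxE]
      by_cases hx1 : ∃ i : Fin (k + 1), i ≠ 0 ∧ x = s(sN, ut i)
      · have h2 : (if x ∈ E' then ξ' x else 0) ≤ 0 := by
          split_ifs with h3
          · obtain ⟨i, hi, rfl⟩ := hx1
            by_cases h4 : θ₂ ≤ θ₁
            · have h5 := hξ'π _ h3
              rw [hπ', if_pos h4, if_pos ⟨i, hi, rfl⟩] at h5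
              exact h5
            · exact absurd h3 (hE'B h4 i hi)
          · exact le_rfl
        have h3 := hξ0 x hxE
        split_ifs at h2 ⊢ <;> linarith
      · have h2 : x ∉ (Finset.univ.filter (fun i : Fin (k + 1) => i ≠ 0)).image
            (fun i => s(sN, ut i)) := by
          intro h
          obtain ⟨i, hi, h⟩ := Finset.mem_image.1 h
          exact hx1 ⟨i, (Finset.mem_filter.1 hi).2, h.symm⟩
        rw [if_neg h2, add_zero]
        split_ifs with h3
        · rw [hξrest x hxE hx1 (hE'H x h3)]
        · exact hξ0 x hxE
    · have h2 : x ∉ (Finset.univ.filter (fun i : Fin (k + 1) => i ≠ 0)).image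
            (fun i => s(sN, ut i)) := by
          intro h
          obtain ⟨i, hi, h⟩ := Finset.mem_image.1 h
          exact hxE (h ▸ heE i)
      rw [if_neg hxE, if_neg h2, if_neg (fun h => hxE (hE'sub h)), add_zero]
  have hP : ∀ (F₁ : Finset (Sym2 V)) (T : Finset (Fin (k + 1))), F' ⊆ F₁ →
      (∀ i, i ≠ 0 → (∀ e' ∈ F₁, ¬ Shares s(sN, ut i) e') → i ∈ T) →
      (θ₂ ≤ θ₁ ∨ ∃ e' ∈ F₁, Shares s(sN, ut 0) e') →
      ∑ e ∈ G.edgeFinset.filter (fun f => ∀ e' ∈ F₁, ¬ Shares f e'), π e ≤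
        ∑ e ∈ E'.filter (fun f => ∀ e' ∈ F', ¬ Shares f e'), π' e +
          ∑ i ∈ T, π s(sN, ut i) := by
    intro F₁ T hsub hT h0
    rw [← Finset.sum_image (s := T) (g := fun i => s(sN, ut i)) (f := π)
      (fun i _ j _ h => einj i j h)]
    apply sum_le_add _ _ _ _ _ _ _ hπ'0 (fun x _ => hπ x)
    intro x hx
    obtain ⟨hxE, hxU⟩ := Finset.mem_filter.1 hx
    by_cases hx1 : ∃ i : Fin (k + 1), i ≠ 0 ∧ x = s(sN, ut i)
    · right; left
      obtain ⟨i, hi, rfl⟩ := hx1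
      exact ⟨Finset.mem_image_of_mem (fun i => s(sN, ut i)) (hT i hi hxU), le_rfl⟩
    by_cases hx2 : ∃ i : Fin (k + 1), i ≠ 0 ∧ ∃ x' ∈ Vch i, x = s(ut i, x')
    · right; right; right
      obtain ⟨i, hi, y, hy, rfl⟩ := hx2
      exact (hπH i hi y hy).le
    left
    have hxE' : x ∈ E' := by
      by_contra hc
      rcases hE'cover x hxE hc with h | h
      · exact hx1 h
      · exact hx2 h
    refine ⟨Finset.mem_filter.2 ⟨hxE', fun e' he' => hxU e' (hsub he')⟩, ?_⟩
    rw [hπ']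
    by_cases h5 : θ₂ ≤ θ₁
    · rw [if_pos h5, if_neg hx1]
    · rw [if_neg h5, if_neg]
      rintro rfl
      rcases h0 with h0 | ⟨e', he', h0⟩
      · exact h5 h0
      · exact hxU e' he' h0
  have huniq : ∀ f ∈ F', ∀ g ∈ F', Shares s(sN, ut 0) f → Shares s(sN, ut 0) g → f = g := by
    intro f hf g hg h1 h2
    exact Finset.card_le_one.1 hdeg f (Finset.mem_filter.2 ⟨hf, h1⟩) g
      (Finset.mem_filter.2 ⟨hg, h2⟩)
  have hsh_s : ∀ i f, sN ∈ f → Shares s(sN, ut i) f := fun i f h => ⟨sN, by simp, h⟩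
  have hsh_u : ∀ i f, ut i ∈ f → Shares s(sN, ut i) f := fun i f h => ⟨ut i, by simp, h⟩
  have hF'u : ∀ i, i ≠ 0 → ut i ∈ nodesOf F' → s(sN, ut i) ∈ F' := by
    intro i hi h
    obtain ⟨f, hf, hif⟩ := (mem_nodesOf _ _).1 h
    rw [← hE'u f (hF'E hf) i hi hif]
    exact hf
  have hgoal : ∀ T : Finset (Fin (k + 1)), F' ⊆ F →
      (∀ i, i ≠ 0 → (∀ e' ∈ F, ¬ Shares s(sN, ut i) e') → i ∈ T) →
      (θ₂ ≤ θ₁ ∨ ∃ e' ∈ F, Shares s(sN, ut 0) e') →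
      ∑ e ∈ F, wE e + ∑ v ∈ nodesOf F, wV v + ∑ i ∈ T, π s(sN, ut i) ≤
        ∑ e ∈ F', wE' e + ∑ v ∈ nodesOf F', wV' v + θ →
      edsObj G.edgeFinset F wE wV π ≤ ∑ f ∈ G.edgeFinset, ξ f := by
    intro T h1 h2 h3 h4
    have h5 := hP F T h1 h2 h3
    unfold edsObj at hopt' ⊢
    linarith
  have hwE'ne : ∀ x, (∀ i, x ≠ s(sN, ut i)) → wE' x = wE x := by
    intro x hx
    rw [hwE', if_neg]
    rintro ⟨i, hi⟩
    exact hx i hi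
  have hwE'le : ∀ x, wE' x ≤ wE x := by
    intro x
    by_cases h : ∃ i, x = s(sN, ut i)
    · obtain ⟨i, rfl⟩ := h
      rw [hwE'e i]
      have := le_max_right (θ - wV sN) 0
      exact max_le (by linarith) (hwE _)
    · exact (hwE'ne x (fun i hi => h ⟨i, hi⟩)).le
  have hwV'le : ∀ v, wV' v ≤ wV v := by
    intro v
    by_cases h1 : v = sN
    · rw [h1, hwV's]; exact max_le (by linarith) (hwV _)
    by_cases h2 : ∃ i, v = ut i
    · obtain ⟨i, rfl⟩ := h2
      rw [hwV'u i]
      have := le_max_right (θ - wV sN - wE s(sN, ut i)) 0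
      linarith
    · rw [hwV'other v h1 (fun i hi => h2 ⟨i, hi⟩)]
  have hnodes_union : ∀ (S : Finset (Sym2 V)) (v : V), v ∈ nodesOf (F' ∪ S) →
      v ∈ nodesOf F' ∨ ∃ e ∈ S, v ∈ e := by
    intro S v hv
    obtain ⟨e, he, hve⟩ := (mem_nodesOf _ _).1 hv
    rcases Finset.mem_union.1 he with h | h
    · exact Or.inl ((mem_nodesOf _ _).2 ⟨e, h, hve⟩)
    · exact Or.inr ⟨e, h, hve⟩
  by_cases c1 : (∃ f ∈ F', u₀ ∈ f) ∧ wV sN + wE s(sN, ut 0) < θ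
  · rw [if_pos c1] at hF
    obtain ⟨⟨f₀, hf₀, hu₀⟩, hlt⟩ := c1
    rw [← hu0] at hu₀
    have hno : ∀ i, i ≠ 0 → s(sN, ut i) ∉ F' := by
      intro i hi h
      have h1 := huniq _ h _ hf₀ (hsh_s 0 _ (by simp)) (hsh_u 0 _ hu₀)
      rw [← h1, Sym2.mem_iff] at hu₀
      rcases hu₀ with h2 | h2
      · exact hs_ne 0 h2.symm
      · exact hi (hinj h2).symm
    have he0F : s(sN, ut 0) ∈ F := by rw [hF]; simp
    refine hgoal ∅ (by rw [hF]; exact Finset.subset_union_left) ?_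
      (Or.inr ⟨_, he0F, hsh_s 0 _ (by simp)⟩) ?_
    · intro i hi h
      exact absurd (hsh_s i _ (by simp)) (h _ he0F)
    · have hA : ∑ e ∈ F, wE e ≤ ∑ e ∈ F', wE' e + ∑ e ∈ {s(sN, ut 0)}, wE e := by
        apply sum_le_add _ _ _ _ _ _ _ hwE'0 (fun x _ => hwE x)
        intro x hx
        by_cases hx0 : x = s(sN, ut 0)
        · right; left; exact ⟨by simp [hx0], le_rfl⟩
        have hx' : x ∈ F' := by
          rw [hF] at hx
          rcases Finset.mem_union.1 hx with h | h
          · exact h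
          · exact absurd (Finset.mem_singleton.1 h) hx0
        left
        refine ⟨hx', (hwE'ne x ?_).ge⟩
        rintro i rfl
        by_cases hi : i = 0
        · rw [hi] at hx0; exact hx0 rfl
        · exact hno i hi hx'
      have hB : ∑ v ∈ nodesOf F, wV v ≤ ∑ v ∈ nodesOf F', wV' v +
          ∑ v ∈ {sN, ut 0}, (if v = ut 0 then θ - wV sN - wE s(sN, ut 0) else wV v) := by
        apply sum_le_add _ _ _ _ _ _ _ hwV'0
        · intro x _
          split_ifs
          · linarith
          · exact hwV x
        intro x hx
        by_cases hx1 : x = sN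
        · right; left
          rw [hx1, if_neg (hs_ne 0)]
          exact ⟨by simp, le_rfl⟩
        by_cases hx2 : x = ut 0
        · right; right; left
          refine ⟨(mem_nodesOf _ _).2 ⟨f₀, hf₀, hx2 ▸ hu₀⟩, by simp [hx2], ?_⟩
          rw [if_pos hx2, hx2, hwV'u 0, max_eq_left (by linarith)]
          linarith
        have hx' : x ∈ nodesOf F' := by
          rw [hF] at hx
          rcases hnodes_union _ _ hx with h | ⟨e, he, hxe⟩
          · exact h
          · rw [Finset.mem_singleton.1 he, Sym2.mem_iff] at hxe
            rcases hxe with h | h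
            · exact absurd h hx1
            · exact absurd h hx2
        left
        refine ⟨hx', (hwV'other x hx1 ?_).ge⟩
        rintro i rfl
        have hi : i ≠ 0 := by rintro rfl; exact hx2 rfl
        exact hno i hi (hF'u i hi hx')
      rw [Finset.sum_singleton] at hA
      rw [Finset.sum_pair (hs_ne 0), if_pos rfl, if_neg (hs_ne 0)] at hB
      rw [Finset.sum_empty]
      linarith
  rw [if_neg c1] at hF
  by_cases c2 : ∃ f ∈ F', sN ∈ f
  · rw [if_pos c2] at hF
    subst hF
    obtain ⟨f, hf, hsf⟩ := c2
    obtain ⟨y, rfl⟩ := Sym2.mem_iff_exists.1 hsf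
    have hfE := hE'sub (hF'E hf)
    rw [SimpleGraph.mem_edgeFinset, SimpleGraph.mem_edgeSet] at hfE
    obtain ⟨j, rfl⟩ := hnbr y hfE
    have huq : ∀ i, s(sN, ut i) ∈ F → i = j := by
      intro i hi
      exact einj i j (huniq _ hi _ hf (hsh_s 0 _ (by simp)) (hsh_s 0 _ (by simp)))
    refine hgoal ∅ (Finset.Subset.refl _) ?_ (Or.inr ⟨_, hf, hsh_s 0 _ (by simp)⟩) ?_
    · intro i hi h
      exact absurd (hsh_s i _ (by simp)) (h _ hf)
    · have hA : ∑ e ∈ F, wE e ≤ ∑ e ∈ F, wE' e + ∑ e ∈ {s(sN, ut j)}, (wE e - wE' e) := by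
        apply sum_le_add _ _ _ _ _ _ _ hwE'0 (fun x _ => sub_nonneg.2 (hwE'le x))
        intro x hx
        by_cases hx0 : x = s(sN, ut j)
        · right; right; left; exact ⟨hx, by simp [hx0], by linarith⟩
        left
        refine ⟨hx, (hwE'ne x ?_).ge⟩
        rintro i rfl
        exact hx0 (by rw [huq i hx])
      have hB : ∑ v ∈ nodesOf F, wV v ≤ ∑ v ∈ nodesOf F, wV' v +
          ∑ v ∈ {sN, ut j}, (wV v - wV' v) := by
        apply sum_le_add _ _ _ _ _ _ _ hwV'0 (fun x _ => sub_nonneg.2 (hwV'le x))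
        intro x hx
        by_cases hx1 : x = sN ∨ x = ut j
        · right; right; left
          exact ⟨hx, by simpa using hx1, by linarith⟩
        push Not at hx1
        left
        refine ⟨hx, (hwV'other x hx1.1 ?_).ge⟩
        rintro i rfl
        by_cases hi : i = 0
        · subst hi
          obtain ⟨g, hg, hug⟩ := (mem_nodesOf _ _).1 hx
          rw [huniq _ hg _ hf (hsh_u 0 _ hug) (hsh_s 0 _ (by simp)), Sym2.mem_iff] at hug
          rcases hug with h | h
          · exact hx1.1 h
          · exact hx1.2 h
        · exact hx1.2 (by rw [huq i (hF'u i hi hx)])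
      rw [Finset.sum_singleton, hwE'e j] at hA
      rw [Finset.sum_pair (hs_ne j), hwV's, hwV'u j] at hB
      rw [Finset.sum_empty]
      have key : wE s(sN, ut j) - max (wE s(sN, ut j) - max (θ - wV sN) 0) 0 +
          (wV sN - max (wV sN - θ) 0 + max (θ - wV sN - wE s(sN, ut j)) 0) = θ := by
        have := hwE s(sN, ut j)
        have := hwV sN
        grind
      linarith
  rw [if_neg c2] at hF
  have hFe : ∀ x ∈ F', wE x ≤ wE' x := by
    intro x hx
    refine (hwE'ne x ?_).ge
    rintro i rfl
    exact c2 ⟨_, hx, by simp⟩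
  have hFv : ∀ v ∈ nodesOf F', wV v ≤ wV' v := by
    intro v hv
    have hv1 : v ≠ sN := by
      rintro rfl
      exact c2 ((mem_nodesOf _ _).1 hv)
    by_cases hv2 : v = ut 0
    · obtain ⟨f, hf, hvf⟩ := (mem_nodesOf _ _).1 hv
      have : ¬ wV sN + wE s(sN, ut 0) < θ := fun h => c1 ⟨⟨f, hf, by rw [← hu0, ← hv2]; exact hvf⟩, h⟩
      rw [hv2, hwV'u 0, max_eq_right (by linarith)]
      linarith
    · refine (hwV'other v hv1 ?_).ge
      rintro i rfl
      have hi : i ≠ 0 := by rintro rfl; exact hv2 rfl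
      exact c2 ⟨_, hF'u i hi hv, by simp⟩
  by_cases c3 : θ₂ ≤ θ₁
  · rw [if_pos c3] at hF
    refine hgoal (Finset.univ.filter (fun i : Fin (k + 1) => i ≠ 0 ∧ i ∉ K))
      (by rw [hF]; exact Finset.subset_union_left) ?_ (Or.inl c3) ?_
    · intro i hi h
      refine Finset.mem_filter.2 ⟨Finset.mem_univ _, hi, fun hiK => ?_⟩
      refine h s(ut i, vsel i) ?_ (hsh_u i _ (by simp))
      rw [hF]
      exact Finset.mem_union_right _ (Finset.mem_image_of_mem (fun i => s(ut i, vsel i)) hiK)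
    · have hA : ∑ e ∈ F, wE e ≤ ∑ e ∈ F', wE' e +
          ∑ e ∈ K.image (fun i => s(ut i, vsel i)), wE e := by
        apply sum_le_add _ _ _ _ _ _ _ hwE'0 (fun x _ => hwE x)
        intro x hx
        rw [hF] at hx
        rcases Finset.mem_union.1 hx with h | h
        · left; exact ⟨h, hFe x h⟩
        · right; left; exact ⟨h, le_rfl⟩
      have hB : ∑ v ∈ nodesOf F, wV v ≤ ∑ v ∈ nodesOf F', wV' v +
          ∑ v ∈ K.image ut ∪ K.image vsel, wV v := by
        apply sum_le_add _ _ _ _ _ _ _ hwV'0 (fun x _ => hwV x)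
        intro x hx
        rw [hF] at hx
        rcases hnodes_union _ _ hx with h | ⟨e, he, hxe⟩
        · left; exact ⟨h, hFv x h⟩
        · right; left
          refine ⟨?_, le_rfl⟩
          obtain ⟨i, hi, rfl⟩ := Finset.mem_image.1 he
          rcases Sym2.mem_iff.1 hxe with h | h
          · rw [h]; exact Finset.mem_union_left _ (Finset.mem_image_of_mem _ hi)
          · rw [h]; exact Finset.mem_union_right _ (Finset.mem_image_of_mem _ hi)
      have hC : ∑ v ∈ K.image ut ∪ K.image vsel, wV v ≤
          ∑ v ∈ K.image ut, wV v + ∑ v ∈ K.image vsel, wV v := by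
        rw [← Finset.sum_union_inter]
        have : 0 ≤ ∑ v ∈ K.image ut ∩ K.image vsel, wV v := Finset.sum_nonneg fun v _ => hwV v
        linarith
      have hD := sum_image_le' K ut wV hwV
      have hD' := sum_image_le' K vsel wV hwV
      have hD'' := sum_image_le' K (fun i => s(ut i, vsel i)) wE hwE
      have hθ2 : θ = θ₂ := by rw [hθ, min_eq_right c3]
      have hsplit : θ₂ = ∑ i ∈ K, (wV (ut i) + wV (vsel i) + wE s(ut i, vsel i)) +
          ∑ i ∈ Finset.univ.filter (fun i : Fin (k + 1) => i ≠ 0 ∧ i ∉ K), π s(sN, ut i) := by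
        rw [hθ₂, ← Finset.sum_filter_add_sum_filter_not _ (fun i => i ∈ K)]
        congr 1
        · refine Finset.sum_congr ?_ ?_
          · ext i; rw [hK]; simp
          · intro i hi
            rw [hK] at hi
            exact min_eq_left (Finset.mem_filter.1 hi).2.2
        · refine Finset.sum_congr ?_ ?_
          · ext i; simp
          · intro i hi
            obtain ⟨-, hi1, hi2⟩ := Finset.mem_filter.1 hi
            apply min_eq_right
            by_contra hc
            apply hi2
            rw [hK]
            exact Finset.mem_filter.2 ⟨Finset.mem_univ _, hi1, by linarith⟩
      rw [Finset.sum_add_distrib, Finset.sum_add_distrib] at hsplit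
      linarith
  · rw [if_neg c3] at hF
    have heF : s(sN, ut istar) ∈ F := by rw [hF]; simp
    refine hgoal ∅ (by rw [hF]; exact Finset.subset_union_left) ?_
      (Or.inr ⟨_, heF, hsh_s 0 _ (by simp)⟩) ?_
    · intro i hi h
      exact absurd (hsh_s i _ (by simp)) (h _ heF)
    · have hA : ∑ e ∈ F, wE e ≤ ∑ e ∈ F', wE' e + ∑ e ∈ {s(sN, ut istar)}, wE e := by
        apply sum_le_add _ _ _ _ _ _ _ hwE'0 (fun x _ => hwE x)
        intro x hx
        rw [hF] at hx
        rcases Finset.mem_union.1 hx with h | h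
        · left; exact ⟨h, hFe x h⟩
        · right; left; exact ⟨h, le_rfl⟩
      have hB : ∑ v ∈ nodesOf F, wV v ≤ ∑ v ∈ nodesOf F', wV' v +
          ∑ v ∈ {sN, ut istar}, wV v := by
        apply sum_le_add _ _ _ _ _ _ _ hwV'0 (fun x _ => hwV x)
        intro x hx
        rw [hF] at hx
        rcases hnodes_union _ _ hx with h | ⟨e, he, hxe⟩
        · left; exact ⟨h, hFv x h⟩
        · right; left
          rw [Finset.mem_singleton.1 he, Sym2.mem_iff] at hxe
          exact ⟨by simpa using hxe, le_rfl⟩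
      have hθ1 : θ = θ₁ := by rw [hθ, min_eq_left (by linarith)]
      rw [Finset.sum_singleton] at hA
      rw [Finset.sum_pair (hs_ne istar)] at hB
      rw [Finset.sum_empty]
      linarith

end EDSCaseBOpt
end

section
/- (Counting lemma for the 2-approximation of multicut in trees.) Let I be an instance of the multicut problem in a tree and let (ξ, ν, μ) be a feasible solution to D(I). Let F' ⊆ E be a multicut such that: (a) w(e) = Σ_{i∈[k]: e∈E_i} ν(e,i) for every e ∈ F'; (b) w(v) = Σ_{i∈[k]: v∈V_i} μ(v,i) for every v ∈ V(F'); (c) ξ(i) = ν(e,i) + μ(u,i) + μ(v,i) for every i ∈ [k] and every edge e = uv ∈ F' ∩ E_i; (d) |F' ∩ E_i| ≤ 2 for every i ∈ [k]; and (e) for every i ∈ [k], every node v ∈ V(F') ∩ V_i with μ(v,i) > 0 is an end node of some edge in F' ∩ E_i. Then w(F') + w(V(F')) ≤ 2 Σ_{i∈[k]} ξ(i). -/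
open scoped Classical

namespace MulticutCounting

variable {V : Type*} [Fintype V] [DecidableEq V]

/-- `V(F)`: the set of end nodes of edges in `F`. -/
noncomputable def nodesOf (F : Finset (Sym2 V)) : Finset V :=
  Finset.univ.filter fun v => ∃ e ∈ F, v ∈ e

/-- Counting lemma for the 2-approximation of multicut in trees: if the
multicut `F'` is tight against the feasible dual solution `(ξ, ν, μ)` in the
sense of (a)–(c), covers each demand path with at most two edges (d), and
every node of `V(F') ∩ V_i` carrying positive dual `μ(v,i)` is an end node of
an edge of `F' ∩ E_i` (e), then `w(F') + w(V(F')) ≤ 2 Σ_i ξ(i)`. -/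
theorem counting_lemma (G : SimpleGraph V) (hG : G.IsTree)
    (wE : Sym2 V → ℝ) (wV : V → ℝ)
    (hwE : ∀ e, 0 ≤ wE e) (hwV : ∀ v, 0 ≤ wV v)
    (k : ℕ) (sv tv : Fin k → V) (hst : ∀ i, sv i ≠ tv i)
    (Ei : Fin k → Finset (Sym2 V)) (Vi : Fin k → Finset V)
    (hpath : ∀ i, ∃ p : G.Walk (sv i) (tv i), p.IsPath ∧
      Ei i = p.edges.toFinset ∧ Vi i = p.support.toFinset)
    -- a feasible solution of the dual LP D(I)
    (ξ : Fin k → ℝ) (ν : Sym2 V → Fin k → ℝ) (μ : V → Fin k → ℝ)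
    (hξ0 : ∀ i, 0 ≤ ξ i)
    (hν0 : ∀ i, ∀ e ∈ Ei i, 0 ≤ ν e i)
    (hμ0 : ∀ i, ∀ v ∈ Vi i, 0 ≤ μ v i)
    (hc1 : ∀ i, ∀ u x : V, s(u, x) ∈ Ei i →
      ξ i ≤ ν s(u, x) i + μ u i + μ x i)
    (hc2 : ∀ e ∈ G.edgeFinset,
      ∑ i ∈ Finset.univ.filter (fun i => e ∈ Ei i), ν e i ≤ wE e)
    (hc3 : ∀ v : V,
      ∑ i ∈ Finset.univ.filter (fun i => v ∈ Vi i), μ v i ≤ wV v)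
    -- the multicut F'
    (F' : Finset (Sym2 V)) (hFE : F' ⊆ G.edgeFinset)
    (hmc : ∀ i, (F' ∩ Ei i).Nonempty)
    -- (a) edges of F' are tight
    (ha : ∀ e ∈ F', wE e = ∑ i ∈ Finset.univ.filter (fun i => e ∈ Ei i), ν e i)
    -- (b) nodes of V(F') are tight
    (hb : ∀ v ∈ nodesOf F',
      wV v = ∑ i ∈ Finset.univ.filter (fun i => v ∈ Vi i), μ v i)
    -- (c) the dual constraints are tight on edges of F'
    (hc : ∀ i, ∀ u x : V, s(u, x) ∈ F' ∩ Ei i →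
      ξ i = ν s(u, x) i + μ u i + μ x i)
    -- (d) each demand path contains at most two edges of F'
    (hd : ∀ i, (F' ∩ Ei i).card ≤ 2)
    -- (e) positive node duals occur only at end nodes of F' ∩ E_i
    (he : ∀ i, ∀ v ∈ nodesOf F', v ∈ Vi i → 0 < μ v i →
      ∃ e ∈ F' ∩ Ei i, v ∈ e) :
    ∑ e ∈ F', wE e + ∑ v ∈ nodesOf F', wV v ≤ 2 * ∑ i, ξ i := by
  have key : ∀ i, ∑ e ∈ F', (if e ∈ Ei i then ν e i else 0)
      + ∑ v ∈ nodesOf F', (if v ∈ Vi i then μ v i else 0) ≤ 2 * ξ i := by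
    intro i
    obtain ⟨p, hp, hE, hV⟩ := hpath i
    have h1 : ∑ e ∈ F', (if e ∈ Ei i then ν e i else 0) = ∑ e ∈ F' ∩ Ei i, ν e i := by
      rw [← Finset.sum_filter, Finset.filter_mem_eq_inter]
    have h2 : ∑ v ∈ nodesOf F', (if v ∈ Vi i then μ v i else 0)
        = ∑ v ∈ nodesOf F' ∩ Vi i, μ v i := by
      rw [← Finset.sum_filter, Finset.filter_mem_eq_inter]
    have h3 : ∑ v ∈ nodesOf F' ∩ Vi i, μ v i
        ≤ ∑ v ∈ nodesOf F' ∩ Vi i, ∑ e ∈ F' ∩ Ei i, (if v ∈ e then μ v i else 0) := by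
      apply Finset.sum_le_sum
      intro v hv
      rw [Finset.mem_inter] at hv
      have hnn := hμ0 i v hv.2
      have hall : ∀ e ∈ F' ∩ Ei i, 0 ≤ (if v ∈ e then μ v i else 0) := by
        intro e _
        split_ifs
        · exact hnn
        · exact le_rfl
      rcases hnn.lt_or_eq with h | h
      · obtain ⟨e, hee, hve⟩ := he i v hv.1 hv.2 h
        have := Finset.single_le_sum hall hee
        rwa [if_pos hve] at this
      · rw [← h]
        rw [← h] at hall
        exact Finset.sum_nonneg hall
    rw [Finset.sum_comm] at h3
    have h4 : ∀ e ∈ F' ∩ Ei i,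
        ν e i + ∑ v ∈ nodesOf F' ∩ Vi i, (if v ∈ e then μ v i else 0) ≤ ξ i := by
      intro e
      induction e using Sym2.ind with
      | _ u x =>
      intro hmem
      have hm := Finset.mem_inter.1 hmem
      have hpe : s(u, x) ∈ p.edges := by
        have := hm.2
        rw [hE] at this
        exact List.mem_toFinset.1 this
      have hu : u ∈ Vi i := by
        rw [hV]; exact List.mem_toFinset.2 (p.fst_mem_support_of_mem_edges hpe)
      have hx : x ∈ Vi i := by
        rw [hV]; exact List.mem_toFinset.2 (p.snd_mem_support_of_mem_edges hpe)
      have hne : u ≠ x := (p.adj_of_mem_edges hpe).ne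
      have : ∑ v ∈ nodesOf F' ∩ Vi i, (if v ∈ s(u, x) then μ v i else 0)
          ≤ ∑ v ∈ ({u, x} : Finset V), μ v i := by
        rw [← Finset.sum_filter]
        apply Finset.sum_le_sum_of_subset_of_nonneg
        · intro v hv
          simpa using (Finset.mem_filter.1 hv).2
        · intro v hv _
          rcases Finset.mem_insert.1 hv with rfl | hv
          · exact hμ0 i _ hu
          · rw [Finset.mem_singleton.1 hv]; exact hμ0 i _ hx
      rw [Finset.sum_pair hne] at this
      rw [hc i u x hmem]
      linarith
    have h5 := Finset.sum_le_sum h4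
    rw [Finset.sum_add_distrib, Finset.sum_const, nsmul_eq_mul] at h5
    have h6 : ((F' ∩ Ei i).card : ℝ) * ξ i ≤ 2 * ξ i :=
      mul_le_mul_of_nonneg_right (by exact_mod_cast hd i) (hξ0 i)
    rw [h1, h2]
    linarith
  have hA : ∑ e ∈ F', wE e = ∑ i, ∑ e ∈ F', (if e ∈ Ei i then ν e i else 0) := by
    rw [Finset.sum_comm]
    refine Finset.sum_congr rfl fun e h => ?_
    rw [ha e h, Finset.sum_filter]
  have hB : ∑ v ∈ nodesOf F', wV v
      = ∑ i, ∑ v ∈ nodesOf F', (if v ∈ Vi i then μ v i else 0) := by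
    rw [Finset.sum_comm]
    refine Finset.sum_congr rfl fun v h => ?_
    rw [hb v h, Finset.sum_filter]
  rw [hA, hB, ← Finset.sum_add_distrib, Finset.mul_sum]
  exact Finset.sum_le_sum fun i _ => key i

end MulticutCounting
end

section
/- (Reduction of prize-collecting multicut to multicut in trees.) Let G = (V,E) be a tree, w : E ∪ V → ℝ≥0, (s_i,t_i), i ∈ [k], demand pairs with s_i ≠ t_i, and π : [k] → ℝ≥0 penalties. Construct the tree G' = (V', E') by adding, for each i ∈ [k], two new nodes s'_i, s''_i and two new edges s_i s'_i and s'_i s''_i, and set weights w'(s'_i s''_i) = π(i), w'(s'_i) = w'(s''_i) = 0, and w' = w on E ∪ V; the demand pairs of G' are (s''_i, t_i), i ∈ [k]. Then min_{C⊆E} [w(C) + w(V(C)) + Σ_{i∈[k]: C∩E_i=∅} π(i)] equals the minimum of w'(C') + w'(V(C')) over all multicuts C' of G' (for the demands (s''_i,t_i)) satisfying C' ∩ {s_i s'_i : i ∈ [k]} = ∅. -/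
open scoped Classical

namespace MulticutReduction

/-- `V(F)`: the set of end nodes of edges in `F`. -/
noncomputable def nodesOf {α : Type*} [Fintype α] [DecidableEq α]
    (F : Finset (Sym2 α)) : Finset α :=
  Finset.univ.filter fun v => ∃ e ∈ F, v ∈ e

variable {V : Type*} [Fintype V] [DecidableEq V]

theorem walk_descend (G : SimpleGraph V) (k : ℕ) (sv : Fin k → V)
    (G' : SimpleGraph (V ⊕ Fin k ⊕ Fin k))
    (hG' : ∀ a b, G'.Adj a b ↔
      ((∃ x y : V, G.Adj x y ∧ a = Sum.inl x ∧ b = Sum.inl y) ∨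
        (∃ i, (a = Sum.inl (sv i) ∧ b = Sum.inr (Sum.inl i)) ∨
          (b = Sum.inl (sv i) ∧ a = Sum.inr (Sum.inl i))) ∨
        (∃ i, (a = Sum.inr (Sum.inl i) ∧ b = Sum.inr (Sum.inr i)) ∨
          (b = Sum.inr (Sum.inl i) ∧ a = Sum.inr (Sum.inr i)))))
    {a b : V ⊕ Fin k ⊕ Fin k} (q : G'.Walk a b) (hq : q.IsPath) :
    ∀ x y : V, a = Sum.inl x → b = Sum.inl y →
      ∃ r : G.Walk x y, q.support = r.support.map Sum.inl ∧
        q.edges = r.edges.map (Sym2.map Sum.inl) := by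
  induction q with
  | nil =>
    intro x y hx hy
    subst hx
    obtain rfl := Sum.inl.inj hy
    exact ⟨SimpleGraph.Walk.nil, by simp, by simp⟩
  | @cons u c w h q ih =>
    intro x y hx hy
    subst hx
    rw [SimpleGraph.Walk.cons_isPath_iff] at hq
    obtain ⟨hq1, hq2⟩ := hq
    rcases (hG' _ _).1 h with ⟨x', z, hadj, h1, h2⟩ | ⟨i, ⟨h1, h2⟩ | ⟨h1, h2⟩⟩ | ⟨i, ⟨h1, h2⟩ | ⟨h1, h2⟩⟩
    · obtain rfl := Sum.inl.inj h1
      obtain ⟨r, hr1, hr2⟩ := ih hq1 z y h2 hy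
      subst h2
      exact ⟨SimpleGraph.Walk.cons hadj r, by simp [hr1], by simp [hr2]⟩
    · exfalso
      obtain rfl := Sum.inl.inj h1
      subst h2
      subst hy
      cases q with
      | @cons _ d _ h' q' =>
        rw [SimpleGraph.Walk.cons_isPath_iff] at hq1
        obtain ⟨hq3, hq4⟩ := hq1
        rcases (hG' _ _).1 h' with ⟨x', z, hadj, h1, h2⟩ | ⟨j, ⟨h1, h2⟩ | ⟨h1, h2⟩⟩ | ⟨j, ⟨h1, h2⟩ | ⟨h1, h2⟩⟩
        · simp at h1
        · simp at h1
        · simp at h2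
          subst h2 h1
          simp at hq2
        · simp at h1
          subst h1 h2
          cases q' with
          | @cons _ d _ h'' q'' =>
            rcases (hG' _ _).1 h'' with ⟨x', z, hadj, h1, h2⟩ | ⟨j, ⟨h1, h2⟩ | ⟨h1, h2⟩⟩ | ⟨j, ⟨h1, h2⟩ | ⟨h1, h2⟩⟩
            · simp at h1
            · simp at h1
            · simp at h2
            · simp at h1
            · simp at h2
              subst h2 h1
              simp at hq4
        · simp at h2
    · simp at h2
    · simp at h1
    · simp at h2

theorem edges_descend (G : SimpleGraph V) (hG : G.IsTree) (k : ℕ) (sv : Fin k → V)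
    (G' : SimpleGraph (V ⊕ Fin k ⊕ Fin k))
    (hG' : ∀ a b, G'.Adj a b ↔
      ((∃ x y : V, G.Adj x y ∧ a = Sum.inl x ∧ b = Sum.inl y) ∨
        (∃ i, (a = Sum.inl (sv i) ∧ b = Sum.inr (Sum.inl i)) ∨
          (b = Sum.inl (sv i) ∧ a = Sum.inr (Sum.inl i))) ∨
        (∃ i, (a = Sum.inr (Sum.inl i) ∧ b = Sum.inr (Sum.inr i)) ∨
          (b = Sum.inr (Sum.inl i) ∧ a = Sum.inr (Sum.inr i)))))
    (i : Fin k) (t : V) (p : G.Walk (sv i) t) (hp : p.IsPath)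
    (q : G'.Walk (Sum.inr (Sum.inr i)) (Sum.inl t)) (hq : q.IsPath) :
    q.edges = s(Sum.inr (Sum.inr i), Sum.inr (Sum.inl i)) ::
      s(Sum.inr (Sum.inl i), Sum.inl (sv i)) :: p.edges.map (Sym2.map Sum.inl) := by
  cases q with
  | @cons _ d _ h q =>
    rw [SimpleGraph.Walk.cons_isPath_iff] at hq
    obtain ⟨hq1, hq2⟩ := hq
    have hd : d = Sum.inr (Sum.inl i) := by
      rcases (hG' _ _).1 h with ⟨x', z, hadj, h1, h2⟩ | ⟨j, ⟨h1, h2⟩ | ⟨h1, h2⟩⟩ | ⟨j, ⟨h1, h2⟩ | ⟨h1, h2⟩⟩ <;> simp_all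
    subst hd
    cases q with
    | @cons _ d _ h' q =>
      rw [SimpleGraph.Walk.cons_isPath_iff] at hq1
      obtain ⟨hq3, hq4⟩ := hq1
      have hd : d = Sum.inl (sv i) := by
        rcases (hG' _ _).1 h' with ⟨x', z, hadj, h1, h2⟩ | ⟨j, ⟨h1, h2⟩ | ⟨h1, h2⟩⟩ | ⟨j, ⟨h1, h2⟩ | ⟨h1, h2⟩⟩
        · simp at h1
        · simp at h1
        · simp at h2
          subst h2
          exact h1
        · simp at h1
          subst h1 h2
          simp at hq2
        · simp at h2
      subst hd
      obtain ⟨r, hr1, hr2⟩ := walk_descend G k sv G' hG' q hq3 _ _ rfl rfl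
      have hr : r.IsPath := by
        rw [SimpleGraph.Walk.isPath_def]
        have := (SimpleGraph.Walk.isPath_def _).1 hq3
        rw [hr1] at this
        exact this.of_map _
      have : r = p := congrArg Subtype.val (hG.IsAcyclic.path_unique ⟨r, hr⟩ ⟨p, hp⟩)
      subst this
      simp [hr2]

/-- Edge set of `G'` given by original edges `C` and penalty edges `J`. -/
noncomputable def lift (k : ℕ) (C : Finset (Sym2 V)) (J : Finset (Fin k)) :
    Finset (Sym2 (V ⊕ Fin k ⊕ Fin k)) :=
  C.image (Sym2.map Sum.inl) ∪
    J.image (fun i => s(Sum.inr (Sum.inl i), Sum.inr (Sum.inr i)))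

theorem mem_lift_orig (k : ℕ) (C : Finset (Sym2 V)) (J : Finset (Fin k)) (e : Sym2 V) :
    Sym2.map Sum.inl e ∈ lift k C J ↔ e ∈ C := by
  have hinj : Function.Injective (Sym2.map (Sum.inl : V → V ⊕ Fin k ⊕ Fin k)) :=
    Sym2.map.injective Sum.inl_injective
  unfold lift
  rw [Finset.mem_union, Finset.mem_image, Finset.mem_image]
  constructor
  · rintro (⟨e', he', h⟩ | ⟨i, hi, h⟩)
    · rwa [← hinj h]
    · exfalso
      induction e with
      | _ x y => simp at h
  · exact fun h => Or.inl ⟨e, h, rfl⟩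

theorem mem_lift_pen (k : ℕ) (C : Finset (Sym2 V)) (J : Finset (Fin k)) (i : Fin k) :
    s(Sum.inr (Sum.inl i), Sum.inr (Sum.inr i)) ∈ lift k C J ↔ i ∈ J := by
  unfold lift
  rw [Finset.mem_union, Finset.mem_image, Finset.mem_image]
  constructor
  · rintro (⟨e, he', h⟩ | ⟨j, hj, h⟩)
    · exfalso
      induction e with
      | _ x y => simp at h
    · simp at h
      rwa [← h]
  · exact fun h => Or.inr ⟨i, h, rfl⟩

theorem not_mem_lift (k : ℕ) (C : Finset (Sym2 V)) (J : Finset (Fin k)) (i : Fin k) (x : V) :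
    s(Sum.inl x, Sum.inr (Sum.inl i)) ∉ lift k C J := by
  unfold lift
  rw [Finset.mem_union, Finset.mem_image, Finset.mem_image]
  rintro (⟨e, he', h⟩ | ⟨j, hj, h⟩)
  · induction e with
    | _ x y => simp at h
  · simp at h

theorem cost_lift (k : ℕ) (C : Finset (Sym2 V)) (J : Finset (Fin k))
    (wE : Sym2 V → ℝ) (wV : V → ℝ) (π : Fin k → ℝ)
    (wE' : Sym2 (V ⊕ Fin k ⊕ Fin k) → ℝ)
    (hwE'orig : ∀ x y : V, wE' s(Sum.inl x, Sum.inl y) = wE s(x, y))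
    (hwE'pen : ∀ i, wE' s(Sum.inr (Sum.inl i), Sum.inr (Sum.inr i)) = π i)
    (wV' : V ⊕ Fin k ⊕ Fin k → ℝ)
    (hwV'orig : ∀ x : V, wV' (Sum.inl x) = wV x)
    (hwV'new : ∀ z : Fin k ⊕ Fin k, wV' (Sum.inr z) = 0) :
    ∑ e ∈ lift k C J, wE' e + ∑ v ∈ nodesOf (lift k C J), wV' v =
      ∑ e ∈ C, wE e + ∑ v ∈ nodesOf C, wV v + ∑ i ∈ J, π i := by
  have hinj : Function.Injective (Sym2.map (Sum.inl : V → V ⊕ Fin k ⊕ Fin k)) :=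
    Sym2.map.injective Sum.inl_injective
  have h1 : ∑ e ∈ lift k C J, wE' e = ∑ e ∈ C, wE e + ∑ i ∈ J, π i := by
    unfold lift
    rw [Finset.sum_union, Finset.sum_image hinj.injOn, Finset.sum_image]
    · congr 1
      · refine Finset.sum_congr rfl fun e _ => ?_
        induction e with
        | _ x y => exact hwE'orig x y
      · exact Finset.sum_congr rfl fun i _ => hwE'pen i
    · intro i _ j _ h
      simpa using h
    · rw [Finset.disjoint_left]
      intro e he he'
      obtain ⟨f, _, rfl⟩ := Finset.mem_image.1 he
      obtain ⟨j, _, h⟩ := Finset.mem_image.1 he'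
      induction f with
      | _ x y => simp at h
  have h2 : ∑ v ∈ nodesOf (lift k C J), wV' v = ∑ v ∈ nodesOf C, wV v := by
    unfold nodesOf
    rw [Finset.sum_filter, Finset.sum_filter, Fintype.sum_sum_type]
    have : ∑ z : Fin k ⊕ Fin k, (if ∃ e ∈ lift k C J, (Sum.inr z : V ⊕ Fin k ⊕ Fin k) ∈ e
        then wV' (Sum.inr z) else 0) = 0 := by
      apply Finset.sum_eq_zero
      intro z _
      simp [hwV'new]
    rw [this, add_zero]
    refine Finset.sum_congr rfl fun x _ => ?_
    rw [hwV'orig]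
    have hiff : (∃ e ∈ lift k C J, (Sum.inl x : V ⊕ Fin k ⊕ Fin k) ∈ e) ↔ ∃ e ∈ C, x ∈ e := by
      constructor
      · rintro ⟨e, he, hx⟩
        unfold lift at he
        rcases Finset.mem_union.1 he with he | he
        · obtain ⟨f, hf, rfl⟩ := Finset.mem_image.1 he
          obtain ⟨y, hy, hxy⟩ := Sym2.mem_map.1 hx
          exact ⟨f, hf, by rwa [← Sum.inl.inj hxy]⟩
        · obtain ⟨f, hf, rfl⟩ := Finset.mem_image.1 he
          simp at hx
      · rintro ⟨e, he, hx⟩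
        exact ⟨_, (mem_lift_orig k C J e).2 he, Sym2.mem_map.2 ⟨x, hx, rfl⟩⟩
    simp only [hiff]
  rw [h1, h2]
  ring

/-- Reduction of the prize-collecting multicut problem in a tree `G` to the
multicut problem in the tree `G'` obtained by attaching, for each demand
`i`, a path `s_i — s'_i — s''_i` with `w'(s'_i s''_i) = π(i)` and zero node
weights, and replacing the demand `(s_i, t_i)` by `(s''_i, t_i)`:  the optimal
prize-collecting multicut value of `G` equals the minimum weight of a multicut
of `G'` avoiding all edges `s_i s'_i`.  (In `V ⊕ Fin k ⊕ Fin k`, `Sum.inl x`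
is an original node, `Sum.inr (Sum.inl i) = s'_i` and
`Sum.inr (Sum.inr i) = s''_i`.) -/
theorem prize_collecting_multicut_reduction (G : SimpleGraph V) (hG : G.IsTree)
    (wE : Sym2 V → ℝ) (wV : V → ℝ)
    (hwE : ∀ e, 0 ≤ wE e) (hwV : ∀ v, 0 ≤ wV v)
    (k : ℕ) (sv tv : Fin k → V) (hst : ∀ i, sv i ≠ tv i)
    (π : Fin k → ℝ) (hπ : ∀ i, 0 ≤ π i)
    (Ei : Fin k → Finset (Sym2 V))
    (hEi : ∀ i, ∃ p : G.Walk (sv i) (tv i), p.IsPath ∧ Ei i = p.edges.toFinset)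
    (G' : SimpleGraph (V ⊕ Fin k ⊕ Fin k))
    (hG' : ∀ a b, G'.Adj a b ↔
      ((∃ x y : V, G.Adj x y ∧ a = Sum.inl x ∧ b = Sum.inl y) ∨
        (∃ i, (a = Sum.inl (sv i) ∧ b = Sum.inr (Sum.inl i)) ∨
          (b = Sum.inl (sv i) ∧ a = Sum.inr (Sum.inl i))) ∨
        (∃ i, (a = Sum.inr (Sum.inl i) ∧ b = Sum.inr (Sum.inr i)) ∨
          (b = Sum.inr (Sum.inl i) ∧ a = Sum.inr (Sum.inr i)))))
    (wE' : Sym2 (V ⊕ Fin k ⊕ Fin k) → ℝ)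
    (hwE'orig : ∀ x y : V, wE' s(Sum.inl x, Sum.inl y) = wE s(x, y))
    (hwE'pen : ∀ i, wE' s(Sum.inr (Sum.inl i), Sum.inr (Sum.inr i)) = π i)
    (wV' : V ⊕ Fin k ⊕ Fin k → ℝ)
    (hwV'orig : ∀ x : V, wV' (Sum.inl x) = wV x)
    (hwV'new : ∀ z : Fin k ⊕ Fin k, wV' (Sum.inr z) = 0)
    (Ei' : Fin k → Finset (Sym2 (V ⊕ Fin k ⊕ Fin k)))
    (hEi' : ∀ i, ∃ p : G'.Walk (Sum.inr (Sum.inr i)) (Sum.inl (tv i)),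
      p.IsPath ∧ Ei' i = p.edges.toFinset) :
    sInf {c : ℝ | ∃ C ⊆ G.edgeFinset,
        (∑ e ∈ C, wE e + ∑ v ∈ nodesOf C, wV v +
          ∑ i ∈ Finset.univ.filter (fun i : Fin k => C ∩ Ei i = ∅), π i) = c} =
      sInf {c : ℝ | ∃ C' ⊆ G'.edgeFinset,
        (∀ i, (C' ∩ Ei' i).Nonempty) ∧
        (∀ i, s(Sum.inl (sv i), Sum.inr (Sum.inl i)) ∉ C') ∧
        (∑ e ∈ C', wE' e + ∑ v ∈ nodesOf C', wV' v) = c} := by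
  have hE : ∀ i, ∀ e, e ∈ Ei' i ↔ (e = s(Sum.inr (Sum.inl i), Sum.inr (Sum.inr i)) ∨
      e = s(Sum.inl (sv i), Sum.inr (Sum.inl i)) ∨ ∃ f ∈ Ei i, Sym2.map Sum.inl f = e) := by
    intro i e
    obtain ⟨p, hp, hpe⟩ := hEi i
    obtain ⟨q, hq, hqe⟩ := hEi' i
    have := edges_descend G hG k sv G' hG' i (tv i) p hp q hq
    rw [hqe, hpe, this, Sym2.eq_swap (a := Sum.inr (Sum.inr i)),
      Sym2.eq_swap (a := Sum.inr (Sum.inl i)) (b := Sum.inl (sv i))]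
    simp
  -- feasibility of lifted sets
  have hfeas : ∀ C J, (∀ i, (lift k C J ∩ Ei' i).Nonempty) ↔ ∀ i, C ∩ Ei i = ∅ → i ∈ J := by
    intro C J
    refine forall_congr' fun i => ?_
    constructor
    · rintro ⟨e, he⟩ hC
      obtain ⟨he1, he2⟩ := Finset.mem_inter.1 he
      rcases (hE i e).1 he2 with rfl | rfl | ⟨f, hf, rfl⟩
      · exact (mem_lift_pen k C J i).1 he1
      · exact absurd he1 (not_mem_lift k C J i _)
      · have : f ∈ C ∩ Ei i := Finset.mem_inter.2 ⟨(mem_lift_orig k C J f).1 he1, hf⟩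
        rw [hC] at this
        simp at this
    · intro h
      by_cases hC : C ∩ Ei i = ∅
      · exact ⟨_, Finset.mem_inter.2 ⟨(mem_lift_pen k C J i).2 (h hC), (hE i _).2 (Or.inl rfl)⟩⟩
      · obtain ⟨f, hf⟩ := Finset.nonempty_iff_ne_empty.2 hC
        obtain ⟨hf1, hf2⟩ := Finset.mem_inter.1 hf
        exact ⟨_, Finset.mem_inter.2 ⟨(mem_lift_orig k C J f).2 hf1,
          (hE i _).2 (Or.inr (Or.inr ⟨f, hf2, rfl⟩))⟩⟩
  have hsub : ∀ C J, C ⊆ G.edgeFinset → lift k C J ⊆ G'.edgeFinset := by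
    intro C J hC e he
    rw [SimpleGraph.mem_edgeFinset]
    unfold lift at he
    rcases Finset.mem_union.1 he with he | he
    · obtain ⟨f, hf, rfl⟩ := Finset.mem_image.1 he
      have hf' := SimpleGraph.mem_edgeFinset.1 (hC hf)
      induction f with
      | _ x y =>
        rw [Sym2.map_mk, SimpleGraph.mem_edgeSet]
        exact (hG' _ _).2 (Or.inl ⟨x, y, hf', rfl, rfl⟩)
    · obtain ⟨i, hi, rfl⟩ := Finset.mem_image.1 he
      rw [SimpleGraph.mem_edgeSet]
      exact (hG' _ _).2 (Or.inr (Or.inr ⟨i, Or.inl ⟨rfl, rfl⟩⟩))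
  have hform : ∀ C' ⊆ G'.edgeFinset,
      (∀ i, s(Sum.inl (sv i), Sum.inr (Sum.inl i)) ∉ C') →
      ∃ C ⊆ G.edgeFinset, ∃ J, C' = lift k C J := by
    intro C' hC' hav
    refine ⟨G.edgeFinset.filter (fun e => Sym2.map Sum.inl e ∈ C'), Finset.filter_subset _ _,
      Finset.univ.filter (fun i => s(Sum.inr (Sum.inl i), Sum.inr (Sum.inr i)) ∈ C'), ?_⟩
    ext e
    constructor
    · intro he
      have he' := SimpleGraph.mem_edgeFinset.1 (hC' he)
      induction e with
      | _ a b =>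
        rw [SimpleGraph.mem_edgeSet] at he'
        rcases (hG' _ _).1 he' with ⟨x, y, hadj, rfl, rfl⟩ | ⟨i, ⟨rfl, rfl⟩ | ⟨rfl, rfl⟩⟩ | ⟨i, ⟨rfl, rfl⟩ | ⟨rfl, rfl⟩⟩
        · refine (mem_lift_orig k _ _ s(x, y)).2 (Finset.mem_filter.2 ⟨?_, he⟩)
          exact SimpleGraph.mem_edgeFinset.2 hadj
        · exact absurd he (hav i)
        · rw [Sym2.eq_swap] at he
          exact absurd he (hav i)
        · exact (mem_lift_pen k _ _ i).2 (by simpa using he)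
        · rw [Sym2.eq_swap] at he ⊢
          exact (mem_lift_pen k _ _ i).2 (by simpa using he)
    · intro he
      unfold lift at he
      rcases Finset.mem_union.1 he with he | he
      · obtain ⟨f, hf, rfl⟩ := Finset.mem_image.1 he
        exact (Finset.mem_filter.1 hf).2
      · obtain ⟨f, hf, rfl⟩ := Finset.mem_image.1 he
        exact (Finset.mem_filter.1 hf).2
  have hcost := fun C J => cost_lift k C J wE wV π wE' hwE'orig hwE'pen wV' hwV'orig hwV'new
  have key : ∀ S T : Set ℝ, S.Nonempty → (∀ c ∈ S, 0 ≤ c) → S ⊆ T →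
      (∀ c ∈ T, ∃ d ∈ S, d ≤ c) → sInf S = sInf T := by
    intro S T hne h0 hST hTS
    have hT0 : ∀ c ∈ T, 0 ≤ c := fun c hc => by
      obtain ⟨d, hd, hdc⟩ := hTS c hc
      exact (h0 d hd).trans hdc
    apply le_antisymm
    · refine le_csInf (hne.mono hST) fun c hc => ?_
      obtain ⟨d, hd, hdc⟩ := hTS c hc
      exact (csInf_le ⟨0, h0⟩ hd).trans hdc
    · exact csInf_le_csInf ⟨0, hT0⟩ hne hST
  apply key
  · exact ⟨_, ∅, Finset.empty_subset _, rfl⟩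
  · rintro c ⟨C, hC, rfl⟩
    have h1 := Finset.sum_nonneg fun e (_ : e ∈ C) => hwE e
    have h2 := Finset.sum_nonneg fun v (_ : v ∈ nodesOf C) => hwV v
    have h3 := Finset.sum_nonneg
      fun i (_ : i ∈ Finset.univ.filter (fun i : Fin k => C ∩ Ei i = ∅)) => hπ i
    exact add_nonneg (add_nonneg h1 h2) h3
  · rintro c ⟨C, hC, rfl⟩
    refine ⟨lift k C (Finset.univ.filter (fun i : Fin k => C ∩ Ei i = ∅)), hsub _ _ hC,
      (hfeas _ _).2 fun i hi => by simpa using hi, fun i => not_mem_lift k _ _ i _, hcost _ _⟩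
  · rintro c ⟨C', hC', hf, hav, rfl⟩
    obtain ⟨C, hC, J, rfl⟩ := hform C' hC' hav
    refine ⟨_, ⟨C, hC, rfl⟩, ?_⟩
    rw [hcost]
    refine add_le_add le_rfl (Finset.sum_le_sum_of_subset_of_nonneg ?_ fun i _ _ => hπ i)
    intro i hi
    exact (hfeas C J).1 hf i (Finset.mem_filter.1 hi).2

end MulticutReduction
end

section
/- (Integrality gap of the natural relaxation for node-weighted EDS on a star.) Let n ≥ 1 and let G be the star with center r, leaves v₁,…,v_n, and edges e_j = r v_j; set w(r) = 1 and w(v_j) = w(e_j) = 0 for all j. Then: (a) every edge dominating set F of G (i.e., every F ⊆ E with δ_F(f) ≠ ∅ for all f ∈ E) satisfies w(F) + w(V(F)) = 1; and (b) the assignment x(e) = 1/n for every edge e and x(v) = 1/n for every node v is feasible for the natural LP relaxation and has objective value Σ_{e∈E} w(e)x(e) + Σ_{v∈V} w(v)x(v) = 1/n. Hence the integrality gap of the natural relaxation on this instance is n. -/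
open scoped Classical

namespace EDSGap

/-- `f` shares an end node with `e` (in particular every edge shares with itself). -/
def Shares {α : Type*} (e f : Sym2 α) : Prop := ∃ x : α, x ∈ e ∧ x ∈ f

/-- `V(F)`: the set of end nodes of edges in `F`. -/
noncomputable def nodesOf {α : Type*} [Fintype α] [DecidableEq α]
    (F : Finset (Sym2 α)) : Finset α :=
  Finset.univ.filter fun v => ∃ e ∈ F, v ∈ e

/-- Integrality gap of the natural LP relaxation for node-weighted EDS on a
star:  on the star with center `none` and `n` leaves `some j`, with node
weight `1` on the center and `0` elsewhere and zero edge weights,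
(a) every edge dominating set has weight exactly `1`, while
(b) the constant assignment `1/n` on edges and nodes is feasible for the
natural LP relaxation and has objective value `1/n`. -/
theorem star_integrality_gap (n : ℕ) (hn : 1 ≤ n)
    (G : SimpleGraph (Option (Fin n)))
    (hGadj : ∀ a b : Option (Fin n), G.Adj a b ↔ a ≠ b ∧ (a = none ∨ b = none))
    (wE : Sym2 (Option (Fin n)) → ℝ) (hwE : ∀ e, wE e = 0)
    (wV : Option (Fin n) → ℝ) (hwV : ∀ v, wV v = if v = none then 1 else 0) :
    -- (a) every edge dominating set has weight 1
    (∀ F ⊆ G.edgeFinset, (∀ f ∈ G.edgeFinset, ∃ e ∈ F, Shares f e) →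
        ∑ e ∈ F, wE e + ∑ v ∈ nodesOf F, wV v = 1) ∧
      -- (b) x ≡ 1/n is feasible for the natural relaxation ...
      ((∀ f ∈ G.edgeFinset,
          1 ≤ ∑ e ∈ G.edgeFinset.filter (fun e => Shares f e), ((1 : ℝ) / n)) ∧
        (∀ (v : Option (Fin n)), ∀ e ∈ G.edgeFinset, v ∈ e →
          ((1 : ℝ) / n) ≤ (1 : ℝ) / n) ∧
        -- ... with objective value 1/n
        (∑ e ∈ G.edgeFinset, wE e * ((1 : ℝ) / n) +
            ∑ v : Option (Fin n), wV v * ((1 : ℝ) / n) = (1 : ℝ) / n)) := by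
  have hnone : ∀ f ∈ G.edgeFinset, none ∈ f := by
    intro f
    induction f using Sym2.ind with
    | _ a b =>
      intro hf
      rw [SimpleGraph.mem_edgeFinset, SimpleGraph.mem_edgeSet, hGadj] at hf
      rcases hf.2 with h | h <;> simp [h]
  have hedge : ∀ j : Fin n, s(none, some j) ∈ G.edgeFinset := by
    intro j
    rw [SimpleGraph.mem_edgeFinset, SimpleGraph.mem_edgeSet, hGadj]
    simp
  have hnpos : (0 : ℝ) < n := by exact_mod_cast hn
  refine ⟨?_, ?_, ?_, ?_⟩
  · intro F hF hdom
    obtain ⟨e, he, -⟩ := hdom _ (hedge ⟨0, hn⟩)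
    have hmem : none ∈ nodesOf F := by
      unfold nodesOf
      rw [Finset.mem_filter]
      exact ⟨Finset.mem_univ _, e, he, hnone e (hF he)⟩
    simp only [hwE, hwV, Finset.sum_const_zero, zero_add]
    rw [Finset.sum_ite_eq', if_pos hmem]
  · intro f hf
    have hcard : n ≤ (G.edgeFinset.filter (fun e => Shares f e)).card := by
      have h := Finset.card_le_card_of_injOn (s := (Finset.univ : Finset (Fin n)))
        (t := G.edgeFinset.filter (fun e => Shares f e))
        (fun j => s(none, some j))
        (by
          intro j _
          rw [Finset.mem_coe, Finset.mem_filter]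
          exact ⟨hedge j, none, hnone f hf, by simp⟩)
        (by
          intro i _ j _ hij
          simpa using hij)
      simpa using h
    rw [Finset.sum_const, nsmul_eq_mul, mul_one_div, le_div_iff₀ hnpos, one_mul]
    exact_mod_cast hcard
  · intro _ _ _ _
    exact le_refl _
  · simp [hwE, hwV]

end EDSGap
end

section
/- (Integrality gap of the natural relaxation for node-weighted multicut on a subdivided star.) Let n ≥ 2 and let G be the tree with center c, nodes s₁,…,s_n and t₁,…,t_n, and edges c s_j and s_j t_j for j ∈ [n]; set w(s_j) = 1 for all j and w = 0 on all other nodes and on all edges; the demand pairs are all pairs (t_i, t_j) with i < j. Then: (a) the minimum of w(C) + w(V(C)) over all multicuts C equals n − 1; and (b) the assignment x(e) = 1/4 for every edge e and x(v) = 1/4 for every node v is feasible for the natural LP relaxation of the multicut problem and has objective value n/4. -/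
open scoped Classical

namespace MulticutGap

/-- `V(F)`: the set of end nodes of edges in `F`. -/
noncomputable def nodesOf {α : Type*} [Fintype α] [DecidableEq α]
    (F : Finset (Sym2 α)) : Finset α :=
  Finset.univ.filter fun v => ∃ e ∈ F, v ∈ e

/-- The edge set of the demand path between `t_i` and `t_j` in the subdivided
star: `t_i — s_i — c — s_j — t_j`, where `c = none`, `s_j = some (j, false)`,
`t_j = some (j, true)`. -/
noncomputable def demandPath (n : ℕ) (i j : Fin n) :
    Finset (Sym2 (Option (Fin n × Bool))) :=
  {s((some (i, true) : Option (Fin n × Bool)), some (i, false)),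
    s((some (i, false) : Option (Fin n × Bool)), none),
    s((none : Option (Fin n × Bool)), some (j, false)),
    s((some (j, false) : Option (Fin n × Bool)), some (j, true))}

/-- Integrality gap of the natural LP relaxation for node-weighted multicut on
a subdivided star with `n ≥ 2` legs, node weight `1` on each subdivision node
`s_j` and `0` elsewhere, zero edge weights, and all pairs `(t_i, t_j)`,
`i < j`, as demands:
(a) the minimum weight of a multicut is `n - 1`, while
(b) the constant assignment `1/4` on edges and nodes is feasible for the
natural LP relaxation and has objective value `n/4`. -/
theorem subdivided_star_integrality_gap (n : ℕ) (hn : 2 ≤ n)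
    (G : SimpleGraph (Option (Fin n × Bool)))
    (hGadj : ∀ a b : Option (Fin n × Bool), G.Adj a b ↔ a ≠ b ∧
      ((a = none ∧ ∃ j, b = some (j, false)) ∨
        (b = none ∧ ∃ j, a = some (j, false)) ∨
        (∃ j, a = some (j, false) ∧ b = some (j, true)) ∨
        (∃ j, b = some (j, false) ∧ a = some (j, true))))
    (wE : Sym2 (Option (Fin n × Bool)) → ℝ) (hwE : ∀ e, wE e = 0)
    (wV : Option (Fin n × Bool) → ℝ)
    (hwV : ∀ v, wV v = if ∃ j, v = some (j, false) then 1 else 0) :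
    -- (a) the minimum multicut weight is n - 1
    ((∀ C ⊆ G.edgeFinset,
        (∀ i j : Fin n, i < j → (C ∩ demandPath n i j).Nonempty) →
        (n : ℝ) - 1 ≤ ∑ e ∈ C, wE e + ∑ v ∈ nodesOf C, wV v) ∧
      (∃ C ⊆ G.edgeFinset,
        (∀ i j : Fin n, i < j → (C ∩ demandPath n i j).Nonempty) ∧
        ∑ e ∈ C, wE e + ∑ v ∈ nodesOf C, wV v = (n : ℝ) - 1)) ∧
      -- (b) x ≡ 1/4 is feasible for the natural relaxation ...
      ((∀ i j : Fin n, i < j → 1 ≤ ∑ e ∈ demandPath n i j, ((1 : ℝ) / 4)) ∧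
        (∀ (v : Option (Fin n × Bool)), ∀ e ∈ G.edgeFinset, v ∈ e →
          ((1 : ℝ) / 4) ≤ (1 : ℝ) / 4) ∧
        -- ... with objective value n/4
        (∑ e ∈ G.edgeFinset, wE e * ((1 : ℝ) / 4) +
            ∑ v : Option (Fin n × Bool), wV v * ((1 : ℝ) / 4) = (n : ℝ) / 4)) := by
  have hsum : ∀ S : Finset (Option (Fin n × Bool)), ∑ v ∈ S, wV v =
      ((Finset.univ.filter fun j : Fin n => (some (j, false) : Option (Fin n × Bool)) ∈ S).card : ℝ) := by
    intro S
    have h0 : ∑ v ∈ S, wV v = ∑ v, if v ∈ S then wV v else 0 := by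
      simp [Finset.sum_ite_mem]
    rw [h0, Fintype.sum_option, Fintype.sum_prod_type]
    simp [hwV]
  have hE : ∀ S : Finset (Sym2 (Option (Fin n × Bool))), ∑ e ∈ S, wE e = 0 := by
    intro S
    simp [hwE]
  have hmem : ∀ (C : Finset (Sym2 (Option (Fin n × Bool)))) (v : Option (Fin n × Bool)),
      v ∈ nodesOf C ↔ ∃ e ∈ C, v ∈ e := by
    intro C v
    simp [nodesOf]
  refine ⟨⟨?_, ?_⟩, ?_, ?_, ?_⟩
  · intro C _ hC
    rw [hE, hsum, zero_add]
    have key : ∀ i j : Fin n, i < j →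
        (some (i, false) : Option (Fin n × Bool)) ∈ nodesOf C ∨
        (some (j, false) : Option (Fin n × Bool)) ∈ nodesOf C := by
      intro i j hij
      obtain ⟨e, he⟩ := hC i j hij
      rw [Finset.mem_inter] at he
      obtain ⟨heC, heP⟩ := he
      rw [hmem, hmem]
      simp only [demandPath, Finset.mem_insert, Finset.mem_singleton] at heP
      rcases heP with h | h | h | h
      · exact Or.inl ⟨e, heC, by simp [h]⟩
      · exact Or.inl ⟨e, heC, by simp [h]⟩
      · exact Or.inr ⟨e, heC, by simp [h]⟩
      · exact Or.inr ⟨e, heC, by simp [h]⟩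
    have h1 : (Finset.univ.filter fun j : Fin n =>
        ¬ (some (j, false) : Option (Fin n × Bool)) ∈ nodesOf C).card ≤ 1 := by
      rw [Finset.card_le_one]
      intro a ha b hb
      simp only [Finset.mem_filter, Finset.mem_univ, true_and] at ha hb
      rcases lt_trichotomy a b with h | h | h
      · rcases key a b h with h' | h' <;> contradiction
      · exact h
      · rcases key b a h with h' | h' <;> contradiction
    have h2 := Finset.card_filter_add_card_filter_not (s := (Finset.univ : Finset (Fin n)))
      (fun j : Fin n => (some (j, false) : Option (Fin n × Bool)) ∈ nodesOf C)
    rw [Finset.card_univ, Fintype.card_fin] at h2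
    rw [sub_le_iff_le_add]
    exact_mod_cast (by omega)
  · have j0 : Fin n := ⟨0, by omega⟩
    refine ⟨(Finset.univ.erase j0).image
      (fun j => s((none : Option (Fin n × Bool)), some (j, false))), ?_, ?_, ?_⟩
    · intro e he
      obtain ⟨j, _, rfl⟩ := Finset.mem_image.1 he
      rw [SimpleGraph.mem_edgeFinset, SimpleGraph.mem_edgeSet, hGadj]
      simp
    · intro i j hij
      by_cases h : i = j0
      · refine ⟨s(none, some (j, false)), Finset.mem_inter.2 ⟨Finset.mem_image.2 ⟨j, ?_, rfl⟩, ?_⟩⟩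
        · have : j ≠ j0 := by rintro rfl; exact absurd hij (by simp [h])
          simp [this]
        · simp [demandPath]
      · refine ⟨s(none, some (i, false)), Finset.mem_inter.2 ⟨Finset.mem_image.2 ⟨i, ?_, rfl⟩, ?_⟩⟩
        · simp [h]
        · simp [demandPath]
    · rw [hE, hsum, zero_add]
      have : (Finset.univ.filter fun j : Fin n => (some (j, false) : Option (Fin n × Bool)) ∈
          nodesOf ((Finset.univ.erase j0).image
            (fun j => s((none : Option (Fin n × Bool)), some (j, false))))) =
          Finset.univ.erase j0 := by
        ext j
        simp [hmem]
      rw [this, Finset.card_erase_of_mem (Finset.mem_univ _), Finset.card_univ, Fintype.card_fin,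
        Nat.cast_sub (by omega), Nat.cast_one]
  · intro i j hij
    have hc : (demandPath n i j).card = 4 := by
      have h1 : i ≠ j := hij.ne
      unfold demandPath
      rw [Finset.card_insert_of_notMem, Finset.card_insert_of_notMem,
        Finset.card_insert_of_notMem, Finset.card_singleton] <;> simp [h1]
    rw [Finset.sum_const, hc]
    norm_num
  · intros
    exact le_rfl
  · rw [← Finset.sum_mul, ← Finset.sum_mul, hE, hsum]
    simp
    ring

end MulticutGap
end

section
/- (Reduction of facility location to EDS in edge- and node-weighted bipartite graphs.) Let V be a nonempty finite client set, F a nonempty finite facility set, o : F → ℝ≥0 opening costs, and d : V × F → ℝ≥0 connection costs. Construct the bipartite graph G whose node set is V ∪ F ∪ {v' : v ∈ V} and whose edge set consists of all edges vf (v ∈ V, f ∈ F) and the pendant edges e_v = v v' (v ∈ V); set weights w(vf) = d(v,f), w(e_v) = 0, w(v) = w(v') = 0 for v ∈ V, and w(f) = o(f) for f ∈ F. Then min_{ρ : V → F} [ Σ_{f ∈ ρ(V)} o(f) + Σ_{v∈V} d(v, ρ(v)) ] equals the minimum of w(S) + w(V(S)) over all edge dominating sets S of G satisfying S ∩ {e_v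 : v ∈ V} = ∅. -/
open scoped Classical

namespace FLReduction

/-- `f` shares an end node with `e` (in particular every edge shares with itself). -/
def Shares {α : Type*} (e f : Sym2 α) : Prop := ∃ x : α, x ∈ e ∧ x ∈ f

/-- `V(S)`: the set of end nodes of edges in `S`. -/
noncomputable def nodesOf {α : Type*} [Fintype α] [DecidableEq α]
    (S : Finset (Sym2 α)) : Finset α :=
  Finset.univ.filter fun v => ∃ e ∈ S, v ∈ e

variable {V F : Type*} [Fintype V] [DecidableEq V] [Fintype F] [DecidableEq F]
  [Nonempty V] [Nonempty F]

/-- Reduction of the facility location problem to the EDS problem in an edge-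
and node-weighted bipartite graph.  On the node set `V ⊕ F ⊕ V` (clients
`Sum.inl v`, facilities `Sum.inr (Sum.inl f)`, copies `v' = Sum.inr (Sum.inr v)`),
the graph `G` has all client–facility edges and the pendant edges `e_v = v v'`;
edge weights are the connection costs and `0` on pendant edges, node weights
are the opening costs on facilities and `0` elsewhere.  Then the optimal
facility location cost equals the minimum weight of an edge dominating set of
`G` containing no pendant edge. -/
theorem facility_location_to_EDS
    (o : F → ℝ) (d : V × F → ℝ) (ho : ∀ f, 0 ≤ o f) (hd : ∀ p, 0 ≤ d p)
    (G : SimpleGraph (V ⊕ F ⊕ V))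
    (hGadj : ∀ a b : V ⊕ F ⊕ V, G.Adj a b ↔
      ((∃ (v : V) (f : F), (a = Sum.inl v ∧ b = Sum.inr (Sum.inl f)) ∨
          (b = Sum.inl v ∧ a = Sum.inr (Sum.inl f))) ∨
        (∃ v : V, (a = Sum.inl v ∧ b = Sum.inr (Sum.inr v)) ∨
          (b = Sum.inl v ∧ a = Sum.inr (Sum.inr v)))))
    (wE : Sym2 (V ⊕ F ⊕ V) → ℝ)
    (hwEconn : ∀ (v : V) (f : F), wE s(Sum.inl v, Sum.inr (Sum.inl f)) = d (v, f))
    (hwEpend : ∀ v : V, wE s(Sum.inl v, Sum.inr (Sum.inr v)) = 0)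
    (wV : V ⊕ F ⊕ V → ℝ)
    (hwVclient : ∀ v : V, wV (Sum.inl v) = 0)
    (hwVfac : ∀ f : F, wV (Sum.inr (Sum.inl f)) = o f)
    (hwVcopy : ∀ v : V, wV (Sum.inr (Sum.inr v)) = 0) :
    sInf {c : ℝ | ∃ ρ : V → F,
        (∑ f ∈ Finset.univ.image ρ, o f + ∑ v : V, d (v, ρ v)) = c} =
      sInf {c : ℝ | ∃ S ⊆ G.edgeFinset,
        (∀ e ∈ G.edgeFinset, ∃ e' ∈ S, Shares e e') ∧
        (∀ v : V, s(Sum.inl v, Sum.inr (Sum.inr v)) ∉ S) ∧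
        (∑ e ∈ S, wE e + ∑ u ∈ nodesOf S, wV u) = c} := by
  have hcost : ∀ S : Finset (Sym2 (V ⊕ F ⊕ V)), ∑ u ∈ nodesOf S, wV u =
      ∑ f ∈ Finset.univ.filter (fun f : F => ∃ e ∈ S, Sum.inr (Sum.inl f) ∈ e), o f := by
    intro S
    unfold nodesOf
    rw [Finset.sum_filter, Finset.sum_filter, Fintype.sum_sum_type, Fintype.sum_sum_type]
    simp [hwVclient, hwVfac, hwVcopy]
  have hinj : Function.Injective
      (fun p : V × F => (s(Sum.inl p.1, Sum.inr (Sum.inl p.2)) : Sym2 (V ⊕ F ⊕ V))) := by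
    rintro ⟨v, f⟩ ⟨v', f'⟩ h
    simpa using h
  have hwnn : ∀ e ∈ G.edgeFinset, 0 ≤ wE e := by
    intro e he
    induction e using Sym2.ind with
    | _ a b =>
      rw [SimpleGraph.mem_edgeFinset, SimpleGraph.mem_edgeSet, hGadj] at he
      rcases he with ⟨v, f, ⟨rfl, rfl⟩ | ⟨rfl, rfl⟩⟩ | ⟨v, ⟨rfl, rfl⟩ | ⟨rfl, rfl⟩⟩
      · rw [hwEconn]; exact hd _
      · rw [Sym2.eq_swap, hwEconn]; exact hd _
      · rw [hwEpend]
      · rw [Sym2.eq_swap, hwEpend]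
  -- the edge set of an assignment, and its weights
  have hEsum : ∀ ρ : V → F,
      ∑ e ∈ Finset.univ.image (fun v : V =>
        (s(Sum.inl v, Sum.inr (Sum.inl (ρ v))) : Sym2 (V ⊕ F ⊕ V))), wE e =
      ∑ v : V, d (v, ρ v) := by
    intro ρ
    rw [Finset.sum_image]
    · simp [hwEconn]
    · intro v _ v' _ h
      exact congrArg Prod.fst (@hinj (v, ρ v) (v', ρ v') h)
  set A := {c : ℝ | ∃ ρ : V → F,
        (∑ f ∈ Finset.univ.image ρ, o f + ∑ v : V, d (v, ρ v)) = c} with hA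
  set B := {c : ℝ | ∃ S ⊆ G.edgeFinset,
        (∀ e ∈ G.edgeFinset, ∃ e' ∈ S, Shares e e') ∧
        (∀ v : V, s(Sum.inl v, Sum.inr (Sum.inr v)) ∉ S) ∧
        (∑ e ∈ S, wE e + ∑ u ∈ nodesOf S, wV u) = c} with hB
  have hAB : A ⊆ B := by
    rintro c ⟨ρ, rfl⟩
    refine ⟨Finset.univ.image (fun v : V =>
        (s(Sum.inl v, Sum.inr (Sum.inl (ρ v))) : Sym2 (V ⊕ F ⊕ V))), ?_, ?_, ?_, ?_⟩
    · intro e he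
      obtain ⟨v, -, rfl⟩ := Finset.mem_image.1 he
      rw [SimpleGraph.mem_edgeFinset, SimpleGraph.mem_edgeSet, hGadj]
      exact Or.inl ⟨v, ρ v, Or.inl ⟨rfl, rfl⟩⟩
    · intro e he
      have key : ∃ v : V, Sum.inl v ∈ e := by
        induction e using Sym2.ind with
        | _ a b =>
          rw [SimpleGraph.mem_edgeFinset, SimpleGraph.mem_edgeSet, hGadj] at he
          rcases he with ⟨v, f, ⟨rfl, rfl⟩ | ⟨rfl, rfl⟩⟩ | ⟨v, ⟨rfl, rfl⟩ | ⟨rfl, rfl⟩⟩ <;>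
            exact ⟨v, by simp⟩
      obtain ⟨v, hv⟩ := key
      exact ⟨_, Finset.mem_image_of_mem _ (Finset.mem_univ v), Sum.inl v, hv, by simp⟩
    · intro v hv
      obtain ⟨v', -, h⟩ := Finset.mem_image.1 hv
      simp at h
    · rw [hEsum, hcost, add_comm]
      congr 1
      apply Finset.sum_congr _ (fun _ _ => rfl)
      ext f
      simp [eq_comm]
  have hBA : ∀ b ∈ B, ∃ a ∈ A, a ≤ b := by
    rintro c ⟨S, hS, hdom, hpend, rfl⟩
    have hex : ∀ v : V, ∃ f : F,
        (s(Sum.inl v, Sum.inr (Sum.inl f)) : Sym2 (V ⊕ F ⊕ V)) ∈ S := by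
      intro v
      have hv : (s(Sum.inl v, Sum.inr (Sum.inr v)) : Sym2 (V ⊕ F ⊕ V)) ∈ G.edgeFinset := by
        rw [SimpleGraph.mem_edgeFinset, SimpleGraph.mem_edgeSet, hGadj]
        exact Or.inr ⟨v, Or.inl ⟨rfl, rfl⟩⟩
      obtain ⟨e, heS, x, hx, hxe⟩ := hdom _ hv
      have he := hS heS
      induction e using Sym2.ind with
      | _ a b =>
        rw [SimpleGraph.mem_edgeFinset, SimpleGraph.mem_edgeSet, hGadj] at he
        rcases he with ⟨u, f, ⟨rfl, rfl⟩ | ⟨rfl, rfl⟩⟩ | ⟨u, ⟨rfl, rfl⟩ | ⟨rfl, rfl⟩⟩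
        · have : u = v := by
            rcases Sym2.mem_iff.1 hx with rfl | rfl <;> simp at hxe
            exact hxe.symm
          subst this
          exact ⟨f, heS⟩
        · have : u = v := by
            rcases Sym2.mem_iff.1 hx with rfl | rfl <;> simp at hxe
            exact hxe.symm
          subst this
          exact ⟨f, by rw [Sym2.eq_swap]; exact heS⟩
        · exact absurd heS (hpend u)
        · exact absurd (by rw [Sym2.eq_swap]; exact heS) (hpend u)
    choose ρ hρ using hex
    refine ⟨_, ⟨ρ, rfl⟩, ?_⟩
    rw [hcost, add_comm, ← hEsum ρ]
    apply add_le_add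
    · apply Finset.sum_le_sum_of_subset_of_nonneg
      · intro e he
        obtain ⟨v, -, rfl⟩ := Finset.mem_image.1 he
        exact hρ v
      · intro e he _
        exact hwnn e (hS he)
    · apply Finset.sum_le_sum_of_subset_of_nonneg
      · intro f hf
        obtain ⟨v, -, rfl⟩ := Finset.mem_image.1 hf
        exact Finset.mem_filter.2 ⟨Finset.mem_univ _, _, hρ v, by simp⟩
      · intro f _ _
        exact ho f
  have hA0 : ∀ a ∈ A, 0 ≤ a := by
    rintro a ⟨ρ, rfl⟩
    exact add_nonneg (Finset.sum_nonneg fun f _ => ho f) (Finset.sum_nonneg fun v _ => hd _)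
  have hAne : A.Nonempty := ⟨_, fun _ => Classical.arbitrary F, rfl⟩
  have hAbdd : BddBelow A := ⟨0, hA0⟩
  have hBbdd : BddBelow B := ⟨0, fun b hb => by
    obtain ⟨a, ha, hab⟩ := hBA b hb
    exact (hA0 a ha).trans hab⟩
  apply le_antisymm
  · apply le_csInf (hAne.mono hAB)
    intro b hb
    obtain ⟨a, ha, hab⟩ := hBA b hb
    exact (csInf_le hAbdd ha).trans hab
  · exact csInf_le_csInf hBbdd hAne hAB

end FLReduction
end

section
/- (First half of the EDS-to-edge-cover lemma.) Let I = (G, w, π) be an instance of the prize-collecting EDS problem, and let (x, y, z) be a feasible solution to the LP relaxation P(I) such that for every e ∈ E there exists e' ∈ δ(e) with x(e) ≤ y(e', e). Let U = {v ∈ V : Σ_{e∈δ(v)} x(e) ≥ 1/4}. Then (4x(e))_{e∈E} together with (4x(v))_{v∈V} is a feasible solution of the LP relaxation EC(I') of the edge cover instance I' = (G, U, w). Consequently, the optimum value of EC(I') is at most 4 (Σ_{e∈E} w(e)x(e) + Σ_{v∈V} w(v)x(v)). -/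
open scoped Classical

namespace EDSToEdgeCover

variable {V : Type*} [Fintype V] [DecidableEq V]

/-- `f` shares an end node with `e` (in particular every edge shares with itself). -/
def Shares (e f : Sym2 V) : Prop := ∃ x : V, x ∈ e ∧ x ∈ f

/-- First half of the EDS-to-edge-cover lemma: if `(x, y, z)` is a feasible
solution of the LP relaxation `P(I)` of the prize-collecting EDS instance such
that for every `e` there is `e' ∈ δ(e)` with `x(e) ≤ y(e', e)`, and
`U = {v : Σ_{e ∈ δ(v)} x(e) ≥ 1/4}`, then `4x` is feasible for the LP
relaxation `EC(I')` of the edge cover instance `I' = (G, U, w)`, and hence the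
optimum of `EC(I')` is at most `4 (Σ w(e)x(e) + Σ w(v)x(v))`. -/
theorem eds_to_edge_cover_first (G : SimpleGraph V)
    (wE : Sym2 V → ℝ) (wV : V → ℝ) (π : Sym2 V → ℝ)
    (hwE : ∀ e, 0 ≤ wE e) (hwV : ∀ v, 0 ≤ wV v) (hπ : ∀ e, 0 ≤ π e)
    -- a feasible solution (x, y, z) of P(I)
    (x : Sym2 V → ℝ) (xv : V → ℝ) (y : Sym2 V → Sym2 V → ℝ) (z : Sym2 V → ℝ)
    (hx0 : ∀ e ∈ G.edgeFinset, 0 ≤ x e) (hxv0 : ∀ v : V, 0 ≤ xv v)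
    (hy0 : ∀ e' ∈ G.edgeFinset, ∀ e ∈ G.edgeFinset, Shares e' e → 0 ≤ y e' e)
    (hz0 : ∀ e ∈ G.edgeFinset, 0 ≤ z e)
    (hcov : ∀ e' ∈ G.edgeFinset,
      1 - z e' ≤ ∑ e ∈ G.edgeFinset.filter (fun e => Shares e' e), y e' e)
    (hnode : ∀ v : V, ∀ e' ∈ G.edgeFinset,
      ∑ e ∈ G.edgeFinset.filter (fun e => Shares e' e ∧ v ∈ e), y e' e ≤ xv v)
    (hedge : ∀ e' ∈ G.edgeFinset, ∀ e ∈ G.edgeFinset, Shares e' e → y e' e ≤ x e)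
    -- minimality of x
    (hmin : ∀ e ∈ G.edgeFinset, ∃ e' ∈ G.edgeFinset, Shares e' e ∧ x e ≤ y e' e)
    (U : Finset V)
    (hU : U = Finset.univ.filter (fun v =>
      (1 / 4 : ℝ) ≤ ∑ e ∈ G.edgeFinset.filter (fun e => v ∈ e), x e)) :
    -- 4x is feasible for EC(I')
    ((∀ e ∈ G.edgeFinset, 0 ≤ 4 * x e) ∧ (∀ v : V, 0 ≤ 4 * xv v) ∧
      (∀ v ∈ U, 1 ≤ ∑ e ∈ G.edgeFinset.filter (fun e => v ∈ e), 4 * x e) ∧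
      (∀ v : V, ∀ e ∈ G.edgeFinset, v ∈ e → 4 * x e ≤ 4 * xv v)) ∧
      -- hence EC(I') ≤ 4 (Σ w(e)x(e) + Σ w(v)x(v))
      sInf {c : ℝ | ∃ (x' : Sym2 V → ℝ) (xv' : V → ℝ),
        ((∀ e ∈ G.edgeFinset, 0 ≤ x' e) ∧ (∀ v : V, 0 ≤ xv' v) ∧
          (∀ v ∈ U, 1 ≤ ∑ e ∈ G.edgeFinset.filter (fun e => v ∈ e), x' e) ∧
          (∀ v : V, ∀ e ∈ G.edgeFinset, v ∈ e → x' e ≤ xv' v)) ∧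
        (∑ e ∈ G.edgeFinset, wE e * x' e + ∑ v : V, wV v * xv' v) = c} ≤
      4 * (∑ e ∈ G.edgeFinset, wE e * x e + ∑ v : V, wV v * xv v) := by
  have hfeas : ((∀ e ∈ G.edgeFinset, 0 ≤ 4 * x e) ∧ (∀ v : V, 0 ≤ 4 * xv v) ∧
      (∀ v ∈ U, 1 ≤ ∑ e ∈ G.edgeFinset.filter (fun e => v ∈ e), 4 * x e) ∧
      (∀ v : V, ∀ e ∈ G.edgeFinset, v ∈ e → 4 * x e ≤ 4 * xv v)) := by
    refine ⟨fun e he => by linarith [hx0 e he], fun v => by linarith [hxv0 v], ?_, ?_⟩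
    · intro v hv
      rw [hU, Finset.mem_filter] at hv
      rw [← Finset.mul_sum]
      linarith [hv.2]
    · intro v e he hve
      obtain ⟨e', he', hs, hle⟩ := hmin e he
      have h1 : y e' e ≤
          ∑ f ∈ G.edgeFinset.filter (fun f => Shares e' f ∧ v ∈ f), y e' f := by
        refine Finset.single_le_sum (f := fun f => y e' f) ?_ ?_
        · intro f hf
          rw [Finset.mem_filter] at hf
          exact hy0 e' he' f hf.1 hf.2.1
        · rw [Finset.mem_filter]
          exact ⟨he, hs, hve⟩
      linarith [hnode v e' he']
  refine ⟨hfeas, csInf_le ⟨0, ?_⟩ ⟨fun e => 4 * x e, fun v => 4 * xv v, hfeas, ?_⟩⟩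
  · rintro c ⟨x', xv', ⟨h1, h2, -, -⟩, rfl⟩
    exact add_nonneg (Finset.sum_nonneg fun e he => mul_nonneg (hwE e) (h1 e he))
      (Finset.sum_nonneg fun v _ => mul_nonneg (hwV v) (h2 v))
  · rw [mul_add, Finset.mul_sum, Finset.mul_sum]
    congr 1 <;> exact Finset.sum_congr rfl fun _ _ => by ring

end EDSToEdgeCover
end

section
/- (Second half of the EDS-to-edge-cover lemma.) Let I = (G, w, π) be an instance of the prize-collecting EDS problem and let (x, y, z) be a feasible solution to the LP relaxation P(I). Let U = {v ∈ V : Σ_{e∈δ(v)} x(e) ≥ 1/4}, and let F ⊆ E be any edge cover of (G, U), i.e., δ_F(v) ≠ ∅ for every v ∈ U. Then every edge e ∈ E with z(e) ≤ 1/2 is dominated by F, i.e., δ_F(e) ≠ ∅. Consequently, the total penalty paid by F satisfies Σ_{e∈E : δ_F(e)=∅} π(e) ≤ 2 Σ_{e∈E} π(e) z(e). -/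
open scoped Classical

namespace EDSToEdgeCoverSecond

variable {V : Type*} [Fintype V] [DecidableEq V]

/-- `f` shares an end node with `e` (in particular every edge shares with itself). -/
def Shares (e f : Sym2 V) : Prop := ∃ x : V, x ∈ e ∧ x ∈ f

/-- Second half of the EDS-to-edge-cover lemma: if `(x, y, z)` is a feasible
solution of the LP relaxation `P(I)` of the prize-collecting EDS instance,
`U = {v : Σ_{e ∈ δ(v)} x(e) ≥ 1/4}`, and `F` is an edge cover of `(G, U)`,
then every edge `e` with `z(e) ≤ 1/2` is dominated by `F`, and hence the total
penalty paid by `F` is at most `2 Σ_{e ∈ E} π(e) z(e)`. -/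
theorem eds_to_edge_cover_second (G : SimpleGraph V)
    (wE : Sym2 V → ℝ) (wV : V → ℝ) (π : Sym2 V → ℝ)
    (hwE : ∀ e, 0 ≤ wE e) (hwV : ∀ v, 0 ≤ wV v) (hπ : ∀ e, 0 ≤ π e)
    -- a feasible solution (x, y, z) of P(I)
    (x : Sym2 V → ℝ) (xv : V → ℝ) (y : Sym2 V → Sym2 V → ℝ) (z : Sym2 V → ℝ)
    (hx0 : ∀ e ∈ G.edgeFinset, 0 ≤ x e) (hxv0 : ∀ v : V, 0 ≤ xv v)
    (hy0 : ∀ e' ∈ G.edgeFinset, ∀ e ∈ G.edgeFinset, Shares e' e → 0 ≤ y e' e)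
    (hz0 : ∀ e ∈ G.edgeFinset, 0 ≤ z e)
    (hcov : ∀ e' ∈ G.edgeFinset,
      1 - z e' ≤ ∑ e ∈ G.edgeFinset.filter (fun e => Shares e' e), y e' e)
    (hnode : ∀ v : V, ∀ e' ∈ G.edgeFinset,
      ∑ e ∈ G.edgeFinset.filter (fun e => Shares e' e ∧ v ∈ e), y e' e ≤ xv v)
    (hedge : ∀ e' ∈ G.edgeFinset, ∀ e ∈ G.edgeFinset, Shares e' e → y e' e ≤ x e)
    (U : Finset V)
    (hU : U = Finset.univ.filter (fun v =>
      (1 / 4 : ℝ) ≤ ∑ e ∈ G.edgeFinset.filter (fun e => v ∈ e), x e))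
    -- an edge cover F of (G, U)
    (F : Finset (Sym2 V)) (hFE : F ⊆ G.edgeFinset)
    (hFcov : ∀ v ∈ U, ∃ f ∈ F, v ∈ f) :
    (∀ e ∈ G.edgeFinset, z e ≤ 1 / 2 → ∃ f ∈ F, Shares e f) ∧
      ∑ e ∈ G.edgeFinset.filter (fun e => ∀ f ∈ F, ¬ Shares e f), π e ≤
        2 * ∑ e ∈ G.edgeFinset, π e * z e := by
  have key : ∀ e ∈ G.edgeFinset, z e ≤ 1 / 2 → ∃ f ∈ F, Shares e f := by
    intro e he hz
    induction e using Sym2.ind with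
    | _ a b =>
    have hU' : ∀ v ∈ s(a, b),
        (1 / 4 : ℝ) ≤ ∑ e ∈ G.edgeFinset.filter (fun e => v ∈ e), x e →
        ∃ f ∈ F, Shares s(a, b) f := by
      intro v hv h
      obtain ⟨f, hf, hvf⟩ := hFcov v (by
        rw [hU]
        exact Finset.mem_filter.2 ⟨Finset.mem_univ _, h⟩)
      exact ⟨f, hf, v, hv, hvf⟩
    by_contra hcon
    have ha := not_le.1 (fun h => hcon (hU' a (Sym2.mem_mk_left a b) h))
    have hb := not_le.1 (fun h => hcon (hU' b (Sym2.mem_mk_right a b) h))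
    have h1 := hcov _ he
    have h2 : ∑ e ∈ G.edgeFinset.filter (fun e => Shares s(a, b) e), y s(a, b) e ≤
        ∑ e ∈ G.edgeFinset.filter (fun e => Shares s(a, b) e), x e := by
      apply Finset.sum_le_sum
      intro i hi
      rw [Finset.mem_filter] at hi
      exact hedge _ he i hi.1 hi.2
    have h3 : ∑ e ∈ G.edgeFinset.filter (fun e => Shares s(a, b) e), x e ≤
        ∑ e ∈ G.edgeFinset.filter (fun e => a ∈ e), x e +
        ∑ e ∈ G.edgeFinset.filter (fun e => b ∈ e), x e := by
      rw [Finset.sum_filter, Finset.sum_filter, Finset.sum_filter, ← Finset.sum_add_distrib]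
      apply Finset.sum_le_sum
      intro i hi
      have h0 := hx0 i hi
      by_cases hia : a ∈ i <;> by_cases hib : b ∈ i <;>
        simp [Shares, hia, hib, h0]
    linarith
  refine ⟨key, ?_⟩
  rw [Finset.sum_filter, Finset.mul_sum]
  apply Finset.sum_le_sum
  intro e he
  have hp := hπ e
  have hz := hz0 e he
  split_ifs with h
  · have : 1 / 2 < z e := by
      by_contra hc
      obtain ⟨f, hf, hs⟩ := key e he (not_lt.1 hc)
      exact h f hf hs
    nlinarith
  · positivity

end EDSToEdgeCoverSecond
end
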